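/- arXiv:1811.09183 — 3 statements merged into one kernel-verified Lean document; each statement's English description precedes it below -/
import Mathlib

section
/- (Maurey–Pisier) Let E be an infinite dimensional Banach space. Then cot E = inf{a ≥ 1 : the identity map id_E : E → E is absolutely (a,1)-summing}, where both sides may equal ∞. -/
open scoped ENNReal NNReal BigOperators ZeroAtInfty

noncomputable section

/-- The `k`-th Rademacher function on `[0,1]`. -/
def Rademacher (k : ℕ) (t : ℝ) : ℝ := (-1 : ℝ) ^ ⌊(2 : ℝ) ^ (k + 1) * t⌋

/-- A Banach space `E` has cotype `q` (for `2 ≤ q < ∞`). -/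
def HasCotype (q : ℝ) (E : Type*) [NormedAddCommGroup E] [NormedSpace ℝ E] : Prop :=
  2 ≤ q ∧ ∃ C > 0, ∀ (n : ℕ) (x : Fin n → E),
    (∑ k : Fin n, ‖x k‖ ^ q) ^ (1 / q) ≤
      C * (∫ t in (0:ℝ)..(1:ℝ), ‖∑ k : Fin n, Rademacher k.1 t • x k‖ ^ 2) ^ ((1:ℝ) / 2)

/-- `cot E`, the infimum of the cotypes of `E` (`∞` if `E` has no finite cotype). -/
def cot (E : Type*) [NormedAddCommGroup E] [NormedSpace ℝ E] : ℝ≥0∞ :=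
  sInf {c : ℝ≥0∞ | ∃ q : ℝ, HasCotype q E ∧ c = ENNReal.ofReal q}

/-- Conjugate exponent in `ℝ≥0∞` : `p* = p/(p-1)`, with `1* = ∞` and `∞* = 1`. -/
def conjE (p : ℝ≥0∞) : ℝ≥0∞ := 1 + 1 / (p - 1)

/-- A sequence is weakly `p`-summable. -/
def WeaklySummable {E : Type*} [NormedAddCommGroup E] [NormedSpace ℝ E]
    (p : ℝ) (x : ℕ → E) : Prop :=
  ∀ φ : E →L[ℝ] ℝ, Summable fun j => |φ (x j)| ^ p

/-- `u : E → F` is absolutely `(q,p)`-summing. -/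
def AbsolutelySumming {E F : Type*} [NormedAddCommGroup E] [NormedSpace ℝ E]
    [NormedAddCommGroup F] [NormedSpace ℝ F] (q p : ℝ) (u : E →L[ℝ] F) : Prop :=
  ∀ x : ℕ → E, WeaklySummable p x → Summable fun j => ‖u (x j)‖ ^ q

/-- The weak `ℓ_p` norm of a sequence. -/
def weakNorm {E : Type*} [NormedAddCommGroup E] [NormedSpace ℝ E] (p : ℝ) (x : ℕ → E) : ℝ :=
  ⨆ φ : {φ : E →L[ℝ] ℝ // ‖φ‖ ≤ 1}, (∑' j, |φ.1 (x j)| ^ p) ^ (1 / p)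

/-- A continuous `m`-linear operator is multiple `(q,p)`-summing. -/
def MultipleSumming {m : ℕ} {E : Fin m → Type*} [∀ i, NormedAddCommGroup (E i)]
    [∀ i, NormedSpace ℝ (E i)] {F : Type*} [NormedAddCommGroup F] [NormedSpace ℝ F]
    (q p : ℝ) (T : ContinuousMultilinearMap ℝ E F) : Prop :=
  ∃ C > 0, ∀ x : (i : Fin m) → ℕ → E i, (∀ i, WeaklySummable p (x i)) →
    (Summable fun j : Fin m → ℕ => ‖T (fun i => x i (j i))‖ ^ q) ∧
    (∑' j : Fin m → ℕ, ‖T (fun i => x i (j i))‖ ^ q) ^ (1 / q) ≤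
      C * ∏ i, weakNorm p (x i)

/-- The signed sum `∑ εᵢ xᵢ`. -/
def signSum {ι E : Type*} [Fintype ι] [NormedAddCommGroup E] [NormedSpace ℝ E]
    (ε : ι → ℤˣ) (x : ι → E) : E :=
  ∑ i, ((ε i : ℤ) : ℝ) • x i

/-- The mean square of `‖∑ εᵢ xᵢ‖` over all choices of signs. -/
def radSq {ι E : Type*} [Fintype ι] [DecidableEq ι] [NormedAddCommGroup E] [NormedSpace ℝ E]
    (x : ι → E) : ℝ :=
  𝔼 ε : ι → ℤˣ, ‖signSum ε x‖ ^ 2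

section Signs

variable {ι κ E : Type*} [Fintype ι] [DecidableEq ι] [Fintype κ] [DecidableEq κ]
  [NormedAddCommGroup E] [NormedSpace ℝ E]

lemma radSq_nonneg (x : ι → E) : 0 ≤ radSq x :=
  Finset.expect_nonneg fun _ _ => by positivity

lemma map_signSum {ι : Type*} [Fintype ι] (f : E →L[ℝ] ℝ) (ε : ι → ℤˣ) (x : ι → E) :
    f (signSum ε x) = ∑ i, ((ε i : ℤ) : ℝ) * f (x i) := by
  simp [signSum, map_sum]

lemma abs_coe_units (u : ℤˣ) : |((u : ℤ) : ℝ)| = 1 := by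
  rcases Int.units_eq_one_or u with h | h <;> simp [h]

lemma expect_mul_signs (δ : ι → ℤˣ) (F : (ι → ℤˣ) → ℝ) :
    𝔼 ε : ι → ℤˣ, F (δ * ε) = 𝔼 ε : ι → ℤˣ, F ε :=
  Fintype.expect_equiv (Equiv.mulLeft δ) _ _ fun _ => rfl

lemma radSq_comp_equiv (e : κ ≃ ι) (x : ι → E) : radSq (x ∘ e) = radSq x := by
  refine (Fintype.expect_equiv (Equiv.arrowCongr e (Equiv.refl _)) _ _ fun ε => ?_)
  congr 2
  exact Fintype.sum_equiv e _ _ fun i => by simp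

lemma radSq_comp_inl_le (x : ι ⊕ κ → E) : radSq (x ∘ Sum.inl) ≤ radSq x := by
  have key : ∀ ε : ι → ℤˣ, ‖signSum ε (x ∘ Sum.inl)‖ ^ 2 ≤
      𝔼 δ : κ → ℤˣ, ‖signSum ε (x ∘ Sum.inl) + signSum δ (x ∘ Sum.inr)‖ ^ 2 := by
    intro ε
    set u := signSum ε (x ∘ Sum.inl)
    have h1 : 𝔼 δ : κ → ℤˣ, ‖u + signSum δ (x ∘ Sum.inr)‖ ^ 2 =
        𝔼 δ : κ → ℤˣ, ‖u - signSum δ (x ∘ Sum.inr)‖ ^ 2 := by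
      rw [← expect_mul_signs (fun _ => -1)]
      refine Finset.expect_congr rfl fun δ _ => ?_
      congr 2
      simp [signSum, sub_eq_add_neg, Finset.sum_neg_distrib]
    have h2 : ‖u‖ ^ 2 ≤ 𝔼 δ : κ → ℤˣ, ((1/2) * ‖u + signSum δ (x ∘ Sum.inr)‖ ^ 2 +
        (1/2) * ‖u - signSum δ (x ∘ Sum.inr)‖ ^ 2) := by
      refine Finset.le_expect Finset.univ_nonempty fun δ _ => ?_
      set v := signSum δ (x ∘ Sum.inr)
      have h3 : 2 * ‖u‖ ≤ ‖u + v‖ + ‖u - v‖ := by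
        calc 2 * ‖u‖ = ‖(u + v) + (u - v)‖ := by
              rw [show (u + v) + (u - v) = (2 : ℝ) • u by rw [two_smul]; abel, norm_smul]; simp
          _ ≤ _ := norm_add_le _ _
      nlinarith [sq_nonneg (‖u + v‖ - ‖u - v‖), norm_nonneg u, norm_nonneg (u+v),
        norm_nonneg (u-v)]
    rw [Finset.expect_add_distrib, ← Finset.mul_expect, ← Finset.mul_expect, ← h1] at h2
    linarith
  calc radSq (x ∘ Sum.inl) ≤ 𝔼 ε : ι → ℤˣ, 𝔼 δ : κ → ℤˣ,
        ‖signSum ε (x ∘ Sum.inl) + signSum δ (x ∘ Sum.inr)‖ ^ 2 :=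
        Finset.expect_le_expect fun ε _ => key ε
    _ = 𝔼 p : (ι → ℤˣ) × (κ → ℤˣ),
        ‖signSum p.1 (x ∘ Sum.inl) + signSum p.2 (x ∘ Sum.inr)‖ ^ 2 := by
        rw [← Finset.univ_product_univ, Finset.expect_product]
    _ = radSq x := by
        refine (Fintype.expect_equiv (Equiv.sumArrowEquivProdArrow ι κ ℤˣ) _ _ fun ε => ?_).symm
        simp [signSum, Equiv.sumArrowEquivProdArrow]

lemma radSq_comp_le {e : κ → ι} (he : Function.Injective e) (x : ι → E) :
    radSq (x ∘ e) ≤ radSq x := by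
  classical
  let g : κ ⊕ {i // i ∉ Set.range e} ≃ ι :=
    ((Equiv.ofInjective e he).sumCongr (Equiv.refl _)).trans
      (Equiv.sumCompl (fun i => i ∈ Set.range e))
  have := radSq_comp_inl_le (x ∘ g)
  rw [radSq_comp_equiv g x] at this
  exact this

lemma sq_norm_le_radSq (x : ι → E) (i : ι) : ‖x i‖ ^ 2 ≤ radSq x := by
  refine le_trans (le_of_eq ?_) (radSq_comp_le (e := fun _ : Unit => i) (fun _ _ _ => rfl) x)
  have : ∀ ε : Unit → ℤˣ, ‖signSum ε (x ∘ fun _ : Unit => i)‖ ^ 2 = ‖x i‖ ^ 2 := fun ε => by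
    simp [signSum, norm_smul, -zsmul_eq_mul, abs_coe_units]
  rw [radSq, Finset.expect_congr rfl fun ε _ => this ε, Fintype.expect_const]

lemma expect_sign_mul_sign (i j : ι) :
    𝔼 ε : ι → ℤˣ, ((ε i : ℤ) : ℝ) * ((ε j : ℤ) : ℝ) = if i = j then 1 else 0 := by
  split_ifs with h
  · subst h
    rw [Finset.expect_congr rfl (g := fun _ => (1:ℝ)) fun ε _ => ?_, Fintype.expect_const]
    rw [← abs_mul_abs_self, abs_coe_units, mul_one]
  · have := expect_mul_signs (Function.update 1 i (-1))
      (fun ε : ι → ℤˣ => ((ε i : ℤ) : ℝ) * ((ε j : ℤ) : ℝ))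
    simp [Function.update_of_ne (Ne.symm h), Finset.expect_neg_distrib] at this
    linarith

lemma sum_sq_eq_expect (a : ι → ℝ) :
    𝔼 ε : ι → ℤˣ, (∑ i, ((ε i : ℤ) : ℝ) * a i) ^ 2 = ∑ i, a i ^ 2 := by
  have : ∀ ε : ι → ℤˣ, (∑ i, ((ε i : ℤ) : ℝ) * a i) ^ 2 =
      ∑ i, ∑ j, (a i * a j) * (((ε i : ℤ) : ℝ) * ((ε j : ℤ) : ℝ)) := fun ε => by
    rw [sq, Finset.sum_mul_sum]
    exact Finset.sum_congr rfl fun i _ => Finset.sum_congr rfl fun j _ => by ring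
  simp_rw [this, Finset.expect_sum_comm, ← Finset.mul_expect, expect_sign_mul_sign]
  simp [sq]

/-- The weak `ℓ₂` norm is dominated by the Rademacher average. -/
lemma sum_sq_apply_le_radSq (x : ι → E) {f : E →L[ℝ] ℝ} (hf : ‖f‖ ≤ 1) :
    ∑ i, f (x i) ^ 2 ≤ radSq x := by
  rw [← sum_sq_eq_expect]
  refine Finset.expect_le_expect fun ε _ => ?_
  rw [← map_signSum, ← sq_abs]
  gcongr
  simpa using f.le_of_opNorm_le hf (signSum ε x)

end Signs

section Symmetrization

variable {T : Type*} [Finite T] [Nonempty T]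

lemma iSup_add_abs_add_iSup_sub_abs_le (h a : T → ℝ) :
    (⨆ τ, (h τ + |a τ|)) + (⨆ τ, (h τ - |a τ|)) ≤ (⨆ τ, (h τ + a τ)) + ⨆ τ, (h τ - a τ) := by
  refine ciSup_add_ciSup_le fun τ τ' => ?_
  have h1 : ∀ τ, h τ + a τ ≤ ⨆ τ, (h τ + a τ) := fun τ =>
    le_ciSup (f := fun τ => h τ + a τ) (Set.finite_range _).bddAbove τ
  have h2 : ∀ τ, h τ - a τ ≤ ⨆ τ, (h τ - a τ) := fun τ =>
    le_ciSup (f := fun τ => h τ - a τ) (Set.finite_range _).bddAbove τ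
  have h3 := abs_abs_sub_abs_le_abs_sub (a τ) (a τ')
  have h4 := le_abs_self (|a τ| - |a τ'|)
  rcases abs_cases (a τ - a τ') with ⟨h5, -⟩ | ⟨h5, -⟩
  · linarith [h1 τ, h2 τ']
  · linarith [h1 τ', h2 τ]

lemma sum_units_int (F : ℤˣ → ℝ) : ∑ u, F u = F 1 + F (-1) := by
  rw [UnitsInt.univ, Finset.sum_pair (by decide)]

lemma sum_signs_succ {n : ℕ} (F : (Fin (n + 1) → ℤˣ) → ℝ) :
    ∑ ε, F ε = (∑ ε : Fin n → ℤˣ, F (Fin.cons 1 ε)) + ∑ ε : Fin n → ℤˣ, F (Fin.cons (-1) ε) := by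
  rw [← sum_units_int (fun u => ∑ ε : Fin n → ℤˣ, F (Fin.cons u ε)), ← Fintype.sum_prod_type']
  exact (Fintype.sum_equiv (Fin.consEquiv fun _ => ℤˣ) _ _ fun p => rfl).symm

/-- The contraction principle for the absolute value. -/
lemma sum_iSup_signs_abs_le {n : ℕ} (h : T → ℝ) (t : T → Fin n → ℝ) :
    ∑ ε : Fin n → ℤˣ, ⨆ τ, (h τ + ∑ i, ((ε i : ℤ) : ℝ) * |t τ i|) ≤
      ∑ ε : Fin n → ℤˣ, ⨆ τ, (h τ + ∑ i, ((ε i : ℤ) : ℝ) * t τ i) := by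
  induction n generalizing h with
  | zero => simp
  | succ n ih =>
    simp only [sum_signs_succ, Fin.sum_univ_succ, Fin.cons_zero, Fin.cons_succ]
    have h1 := ih (fun τ => h τ + |t τ 0|) (fun τ i => t τ i.succ)
    have h2 := ih (fun τ => h τ - |t τ 0|) (fun τ i => t τ i.succ)
    have h3 := Finset.sum_le_sum fun (ε : Fin n → ℤˣ) (_ : ε ∈ Finset.univ) =>
      iSup_add_abs_add_iSup_sub_abs_le
        (fun τ => h τ + ∑ i, ((ε i : ℤ) : ℝ) * t τ i.succ) (fun τ => t τ 0)
    simp only [Finset.sum_add_distrib] at h3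
    simp only [Units.val_one, Int.cast_one, one_mul, Units.val_neg, Int.cast_neg, neg_mul]
    refine (le_of_eq ?_).trans ((add_le_add h1 h2).trans
      ((le_of_eq ?_).trans (h3.trans (le_of_eq ?_))))
    all_goals
      refine congrArg₂ (· + ·) ?_ ?_ <;>
        exact Finset.sum_congr rfl fun ε _ => iSup_congr fun τ => by ring

lemma expect_iSup_signs_abs_le {n : ℕ} (t : T → Fin n → ℝ) :
    𝔼 ε : Fin n → ℤˣ, ⨆ τ, (∑ i, ((ε i : ℤ) : ℝ) * |t τ i|) ≤
      𝔼 ε : Fin n → ℤˣ, ⨆ τ, (∑ i, ((ε i : ℤ) : ℝ) * t τ i) := by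
  have := sum_iSup_signs_abs_le (fun _ => 0) t
  simp only [zero_add] at this
  rw [Fintype.expect_eq_sum_div_card, Fintype.expect_eq_sum_div_card]
  gcongr

lemma expect_pi_prod {ι G : Type*} [Fintype ι] [DecidableEq ι] [Fintype G]
    (F : (ι → G) → (ι → G) → ℝ) :
    𝔼 p : ι → G × G, F (fun i => (p i).1) (fun i => (p i).2) =
      𝔼 κ : ι → G, 𝔼 κ' : ι → G, F κ κ' := by
  rw [← Finset.expect_product' Finset.univ Finset.univ F, Finset.univ_product_univ]
  exact Fintype.expect_equiv (Equiv.arrowProdEquivProdArrow ι (fun _ => G) (fun _ => G)) _ _ fun _ => rfl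

lemma expect_apply_eq {ι G : Type*} [Fintype ι] [DecidableEq ι] [Fintype G] [Nonempty G]
    (i : ι) (F : G → ℝ) : 𝔼 κ : ι → G, F (κ i) = 𝔼 g, F g := by
  rw [Fintype.expect_equiv (Equiv.funSplitAt i G) (fun κ => F (κ i)) (fun p => F p.1) fun κ => rfl,
    ← Finset.univ_product_univ, Finset.expect_product]
  exact Finset.expect_congr rfl fun g _ => Fintype.expect_const (F g)

lemma iSup_expect_le {ι : Type*} [Fintype ι] (F : ι → T → ℝ) :
    ⨆ τ, 𝔼 i, F i τ ≤ 𝔼 i, ⨆ τ, F i τ :=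
  ciSup_le fun τ => Finset.expect_le_expect fun i _ =>
    le_ciSup (f := F i) (Set.finite_range _).bddAbove τ

lemma iSup_add_le_add_iSup (F H : T → ℝ) : ⨆ τ, (F τ + H τ) ≤ (⨆ τ, F τ) + ⨆ τ, H τ :=
  ciSup_le fun τ => add_le_add (le_ciSup (f := F) (Set.finite_range _).bddAbove τ)
    (le_ciSup (f := H) (Set.finite_range _).bddAbove τ)

/-- Symmetrization: a random transversal of an `n × G` array. -/
lemma expect_iSup_transversal_le {n : ℕ} {G : Type*} [Fintype G] [Nonempty G]
    (a : T → Fin n → G → ℝ) :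
    𝔼 κ : Fin n → G, ⨆ τ, ∑ i, |a τ i (κ i)| ≤
      (⨆ τ, ∑ i, 𝔼 g, |a τ i g|) +
        2 * 𝔼 κ : Fin n → G, 𝔼 ε : Fin n → ℤˣ, ⨆ τ, ∑ i, ((ε i : ℤ) : ℝ) * a τ i (κ i) := by
  have hmarg : ∀ τ, ∑ i, 𝔼 g, |a τ i g| = 𝔼 κ' : Fin n → G, ∑ i, |a τ i (κ' i)| := by
    intro τ
    rw [Finset.expect_sum_comm]
    refine Finset.sum_congr rfl fun i _ => ?_
    exact (expect_apply_eq i fun g => |a τ i g|).symm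
  have hswap : ∀ ε : Fin n → ℤˣ,
      𝔼 p : Fin n → G × G, ⨆ τ, ∑ i, (|a τ i (p i).1| - |a τ i (p i).2|) =
      𝔼 p : Fin n → G × G, ⨆ τ, ∑ i, ((ε i : ℤ) : ℝ) * (|a τ i (p i).1| - |a τ i (p i).2|) := by
    intro ε
    refine Fintype.expect_equiv (Equiv.piCongrRight fun i =>
      if ε i = 1 then Equiv.refl _ else Equiv.prodComm G G) _ _ fun p => ?_
    refine iSup_congr fun τ => Finset.sum_congr rfl fun i _ => ?_
    rcases Int.units_eq_one_or (ε i) with h | h <;> simp [h]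
  have h1 : 𝔼 κ : Fin n → G, ⨆ τ, ∑ i, |a τ i (κ i)| ≤ (⨆ τ, ∑ i, 𝔼 g, |a τ i g|) +
      𝔼 κ : Fin n → G, 𝔼 κ' : Fin n → G, ⨆ τ, ∑ i, (|a τ i (κ i)| - |a τ i (κ' i)|) := by
    rw [← Fintype.expect_const (ι := Fin n → G) (⨆ τ, ∑ i, 𝔼 g, |a τ i g|),
      ← Finset.expect_add_distrib]
    refine Finset.expect_le_expect fun κ _ => ?_
    have e1 : ∀ τ, ∑ i, |a τ i (κ i)| = ∑ i, 𝔼 g, |a τ i g| +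
        𝔼 κ' : Fin n → G, ∑ i, (|a τ i (κ i)| - |a τ i (κ' i)|) := fun τ => by
      simp only [Finset.sum_sub_distrib, Finset.expect_sub_distrib, Fintype.expect_const, hmarg]
      ring
    simp_rw [e1]
    exact (iSup_add_le_add_iSup _ _).trans (add_le_add le_rfl (iSup_expect_le _))
  have h2 : 𝔼 κ : Fin n → G, 𝔼 κ' : Fin n → G, ⨆ τ, ∑ i, (|a τ i (κ i)| - |a τ i (κ' i)|) ≤
      2 * 𝔼 κ : Fin n → G, 𝔼 ε : Fin n → ℤˣ, ⨆ τ, ∑ i, ((ε i : ℤ) : ℝ) * |a τ i (κ i)| := by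
    rw [← expect_pi_prod (fun κ κ' => ⨆ τ, ∑ i, (|a τ i (κ i)| - |a τ i (κ' i)|)),
      ← Fintype.expect_const (ι := Fin n → ℤˣ) (Finset.expect _ _),
      Finset.expect_congr rfl fun ε _ => hswap ε]
    set R : (Fin n → ℤˣ) → ℝ := fun ε => 𝔼 κ : Fin n → G, ⨆ τ, ∑ i, ((ε i : ℤ) : ℝ) * |a τ i (κ i)|
    have h3 : ∀ ε : Fin n → ℤˣ, 𝔼 p : Fin n → G × G,
        ⨆ τ, ∑ i, ((ε i : ℤ) : ℝ) * (|a τ i (p i).1| - |a τ i (p i).2|) ≤ R ε + R (-1 * ε) := by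
      intro ε
      rw [expect_pi_prod (fun κ κ' => ⨆ τ, ∑ i, ((ε i : ℤ) : ℝ) * (|a τ i (κ i)| - |a τ i (κ' i)|))]
      calc _ ≤ 𝔼 κ : Fin n → G, 𝔼 κ' : Fin n → G,
            ((⨆ τ, ∑ i, ((ε i : ℤ) : ℝ) * |a τ i (κ i)|) +
              ⨆ τ, ∑ i, (((-1 * ε) i : ℤ) : ℝ) * |a τ i (κ' i)|) := by
            refine Finset.expect_le_expect fun κ _ => Finset.expect_le_expect fun κ' _ => ?_
            refine le_trans (le_of_eq (iSup_congr fun τ => ?_)) (iSup_add_le_add_iSup _ _)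
            rw [← Finset.sum_add_distrib]
            refine Finset.sum_congr rfl fun i _ => ?_
            simp only [Pi.mul_apply, Pi.neg_apply, Pi.one_apply, neg_mul, one_mul,
              Units.val_neg, Int.cast_neg]
            ring
        _ = _ := by
            simp only [Finset.expect_add_distrib, Fintype.expect_const, R]
    refine (Finset.expect_le_expect fun ε _ => h3 ε).trans (le_of_eq ?_)
    rw [Finset.expect_add_distrib, expect_mul_signs (-1) R, Finset.expect_comm, two_mul]
  refine h1.trans (add_le_add le_rfl (h2.trans ?_))
  exact mul_le_mul_of_nonneg_left (Finset.expect_le_expect fun κ _ =>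
    expect_iSup_signs_abs_le fun τ i => a τ i (κ i)) zero_le_two

end Symmetrization

section Transversal

variable {E : Type*} [NormedAddCommGroup E] [NormedSpace ℝ E]

lemma expect_le_sqrt_expect_sq {ι : Type*} [Fintype ι] [Nonempty ι] (F : ι → ℝ) :
    𝔼 i, F i ≤ √(𝔼 i, F i ^ 2) := by
  refine Real.le_sqrt_of_sq_le ?_
  have := Finset.expect_mul_sq_le_sq_mul_sq Finset.univ F (fun _ => 1)
  simpa using this

lemma expect_norm_signSum_le {ι : Type*} [Fintype ι] [DecidableEq ι] (x : ι → E) :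
    𝔼 ε : ι → ℤˣ, ‖signSum ε x‖ ≤ √(radSq x) :=
  expect_le_sqrt_expect_sq _

lemma sum_abs_apply_le {ι : Type*} [Fintype ι] [DecidableEq ι] (x : ι → E) {f : E →L[ℝ] ℝ}
    (hf : ‖f‖ ≤ 1) : ∑ i, |f (x i)| ≤ √(Fintype.card ι) * √(radSq x) := by
  rw [← Real.sqrt_mul (Nat.cast_nonneg _)]
  refine Real.le_sqrt_of_sq_le ?_
  calc (∑ i, |f (x i)|) ^ 2 ≤ (Fintype.card ι : ℝ) * ∑ i, |f (x i)| ^ 2 := by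
        simpa using sq_sum_le_card_mul_sum_sq (s := Finset.univ) (f := fun i => |f (x i)|)
    _ ≤ _ := by
        simp only [sq_abs]
        gcongr
        exact sum_sq_apply_le_radSq x hf

lemma apply_le_norm_of_norm_le_one {f : E →L[ℝ] ℝ} (hf : ‖f‖ ≤ 1) (v : E) : f v ≤ ‖v‖ :=
  (le_abs_self _).trans (by simpa using f.le_of_opNorm_le hf v)

lemma norm_signSum_le_of_norming {ι : Type*} [Fintype ι] (ε : ι → ℤˣ) (x : ι → E) {f : E →L[ℝ] ℝ}
    (hf : f (signSum ε x) = ‖signSum ε x‖) : ‖signSum ε x‖ ≤ ∑ i, |f (x i)| := by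
  rw [← hf, map_signSum]
  refine Finset.sum_le_sum fun i _ => (le_abs_self _).trans ?_
  rw [abs_mul, abs_coe_units, one_mul]

/-- The maximum over signs of a random transversal is controlled by Rademacher averages. -/
lemma expect_iSup_norm_signSum_transversal_le {n : ℕ} {G : Type*} [Fintype G] [DecidableEq G]
    [Nonempty G] (x : Fin n × G → E) :
    𝔼 κ : Fin n → G, ⨆ ε : Fin n → ℤˣ, ‖signSum ε fun i => x (i, κ i)‖ ≤
      √n * √(radSq x) / √(Fintype.card G) +
        2 * 𝔼 κ : Fin n → G, √(radSq fun i => x (i, κ i)) := by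
  choose f hf1 hf2 using fun p : (Fin n → G) × (Fin n → ℤˣ) =>
    exists_dual_vector'' ℝ (signSum p.2 fun i => x (i, p.1 i))
  refine le_trans (Finset.expect_le_expect fun κ _ => ?_)
    ((expect_iSup_transversal_le fun p i g => f p (x (i, g))).trans (add_le_add ?_ ?_))
  · refine ciSup_le fun ε => ?_
    refine le_trans ?_ (le_ciSup (f := fun p => ∑ i, |f p (x (i, κ i))|)
      (Set.finite_range _).bddAbove (κ, ε))
    exact norm_signSum_le_of_norming ε _ (hf2 (κ, ε))
  · refine ciSup_le fun p => ?_
    have h := sum_abs_apply_le x (hf1 p)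
    have hG : (0:ℝ) < Fintype.card G := by exact_mod_cast Fintype.card_pos
    simp_rw [Fintype.expect_eq_sum_div_card, ← Finset.sum_div]
    rw [Fintype.sum_prod_type] at h
    rw [div_le_div_iff₀ hG (Real.sqrt_pos.2 hG)]
    simp only [Fintype.card_prod, Fintype.card_fin, Nat.cast_mul] at h
    rw [Real.sqrt_mul (Nat.cast_nonneg _)] at h
    refine (mul_le_mul_of_nonneg_right h (Real.sqrt_nonneg _)).trans (le_of_eq ?_)
    linear_combination √n * √(radSq x) * Real.mul_self_sqrt hG.le
  · refine mul_le_mul_of_nonneg_left (Finset.expect_le_expect fun κ _ => ?_) zero_le_two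
    refine le_trans (Finset.expect_le_expect fun ε _ => ?_) (expect_norm_signSum_le _)
    refine ciSup_le fun p => ?_
    rw [← map_signSum (f p) ε fun i => x (i, κ i)]
    exact apply_le_norm_of_norm_le_one (hf1 p) _

lemma expect_radSq_column_le {ι G : Type*} [Fintype ι] [DecidableEq ι] [Fintype G] [DecidableEq G]
    {D : ℝ} (hD : ∀ y : G → E, 𝔼 s, ‖y s‖ ^ 2 ≤ D * radSq y) (x : ι × G → E) :
    𝔼 s, radSq (fun i => x (i, s)) ≤ D * radSq x := by
  let S : (ι × G → ℤˣ) → G → E := fun ε s => signSum (fun i => ε (i, s)) fun i => x (i, s)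
  have h1 : radSq x = 𝔼 ε, radSq (S ε) := by
    have : ∀ η : G → ℤˣ, radSq x = 𝔼 ε, ‖signSum η (S ε)‖ ^ 2 := fun η => by
      rw [radSq, ← expect_mul_signs (fun p => η p.2)]
      refine Finset.expect_congr rfl fun ε _ => ?_
      congr 2
      simp only [signSum, S, Fintype.sum_prod_type_right, Finset.smul_sum, smul_smul]
      simp
    rw [← Fintype.expect_const (ι := G → ℤˣ) (radSq x), Finset.expect_congr rfl fun η _ => this η,
      Finset.expect_comm]
    rfl
  have h2 : ∀ s, radSq (fun i => x (i, s)) = 𝔼 ε, ‖S ε s‖ ^ 2 := fun s => by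
    rw [radSq, ← expect_apply_eq s fun δ : ι → ℤˣ => ‖signSum δ fun i => x (i, s)‖ ^ 2]
    exact (Fintype.expect_equiv (((Equiv.prodComm ι G).arrowCongr (Equiv.refl _)).trans
      (Equiv.curry G ι ℤˣ)) _ _ fun ε => rfl).symm
  simp_rw [h2]
  rw [Finset.expect_comm, h1, Finset.mul_expect]
  exact Finset.expect_le_expect fun ε _ => hD _

lemma expect_radSq_transversal_le {ι G : Type*} [Fintype ι] [DecidableEq ι] [Fintype G]
    [DecidableEq G] [AddGroup G]
    {D : ℝ} (hD : ∀ y : G → E, 𝔼 s, ‖y s‖ ^ 2 ≤ D * radSq y) (x : ι × G → E) :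
    𝔼 κ : ι → G, radSq (fun i => x (i, κ i)) ≤ D * radSq x := by
  have h1 : ∀ s : G, 𝔼 κ : ι → G, radSq (fun i => x (i, κ i)) =
      𝔼 κ : ι → G, radSq (fun i => x (i, κ i + s)) := fun s =>
    (Fintype.expect_equiv (Equiv.piCongrRight fun _ => Equiv.addRight s) _ _ fun κ => rfl).symm
  rw [← Fintype.expect_const (ι := G) (Finset.expect _ _), Finset.expect_congr rfl fun s _ => h1 s,
    Finset.expect_comm]
  refine Finset.expect_le Finset.univ_nonempty fun κ _ => ?_
  let e : ι × G ≃ ι × G := Equiv.prodShear (Equiv.refl _) fun i => Equiv.addLeft (κ i)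
  rw [← radSq_comp_equiv e x]
  exact expect_radSq_column_le hD (x ∘ e)

lemma exists_transversal {n : ℕ} {G : Type*} [Fintype G] [DecidableEq G] [AddGroup G]
    {D : ℝ} (hD0 : 0 ≤ D)
    (hD : ∀ y : G → E, 𝔼 s, ‖y s‖ ^ 2 ≤ D * radSq y) (x : Fin n × G → E) :
    ∃ κ : Fin n → G, ∀ ε : Fin n → ℤˣ, ‖signSum ε fun i => x (i, κ i)‖ ≤
      (√n / √(Fintype.card G) + 2 * √D) * √(radSq x) := by
  have h1 := expect_iSup_norm_signSum_transversal_le x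
  have h2 : 𝔼 κ : Fin n → G, √(radSq fun i => x (i, κ i)) ≤ √D * √(radSq x) := by
    rw [← Real.sqrt_mul hD0]
    refine (expect_le_sqrt_expect_sq _).trans (Real.sqrt_le_sqrt ?_)
    simp_rw [Real.sq_sqrt (radSq_nonneg _)]
    exact expect_radSq_transversal_le hD x
  obtain ⟨κ, -, hκ⟩ := Finset.exists_le_of_expect_le Finset.univ_nonempty h1
  refine ⟨κ, fun ε => (le_ciSup (f := fun ε : Fin n → ℤˣ => ‖signSum ε fun i => x (i, κ i)‖)
    (Set.finite_range _).bddAbove ε).trans (hκ.trans ?_)⟩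
  rw [add_mul, div_mul_eq_mul_div]
  linarith

end Transversal

section RademacherIntegral

open MeasureTheory

lemma rademacher_zero_of_lt {t : ℝ} (h0 : 0 < t) (h1 : t < 1 / 2) : Rademacher 0 t = 1 := by
  have : ⌊(2 : ℝ) ^ (0 + 1) * t⌋ = 0 := by
    rw [Int.floor_eq_iff]; constructor <;> norm_num <;> linarith
  rw [Rademacher, this, zpow_zero]

lemma rademacher_zero_of_gt {t : ℝ} (h0 : 1 / 2 < t) (h1 : t < 1) : Rademacher 0 t = -1 := by
  have : ⌊(2 : ℝ) ^ (0 + 1) * t⌋ = 1 := by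
    rw [Int.floor_eq_iff]; constructor <;> norm_num <;> linarith
  rw [Rademacher, this, zpow_one]

lemma rademacher_succ (k : ℕ) (t : ℝ) : Rademacher (k + 1) t = Rademacher k (2 * t) := by
  rw [Rademacher, Rademacher]
  congr 2
  ring

lemma rademacher_sub_one (k : ℕ) (t : ℝ) : Rademacher k (t - 1) = Rademacher k t := by
  rw [Rademacher, Rademacher]
  have : (2 : ℝ) ^ (k + 1) * (t - 1) = 2 ^ (k + 1) * t - ((2 ^ (k + 1) : ℤ) : ℝ) := by
    push_cast; ring
  rw [this, Int.floor_sub_intCast, zpow_sub₀ (by norm_num)]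
  have h : Even ((2 : ℤ) ^ (k + 1)) := (even_two).pow_of_ne_zero (by simp)
  rw [h.neg_one_zpow, div_one]

lemma expect_signs_succ {n : ℕ} (F : (Fin (n + 1) → ℤˣ) → ℝ) :
    𝔼 ε, F ε = 2⁻¹ * 𝔼 ε : Fin n → ℤˣ, F (Fin.cons 1 ε) +
      2⁻¹ * 𝔼 ε : Fin n → ℤˣ, F (Fin.cons (-1) ε) := by
  simp only [Fintype.expect_eq_sum_div_card, sum_signs_succ]
  have : (Fintype.card (Fin (n + 1) → ℤˣ) : ℝ) = 2 * Fintype.card (Fin n → ℤˣ) := by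
    simp [pow_succ']
  rw [this]
  field_simp

/-- The Rademacher functions are independent uniform signs. -/
lemma integral_rademacher {n : ℕ} (F : (Fin n → ℝ) → ℝ) :
    IntervalIntegrable (fun t => F fun k => Rademacher k t) volume 0 1 ∧
      ∫ t in (0:ℝ)..1, F (fun k => Rademacher k t) = 𝔼 ε : Fin n → ℤˣ, F fun k => ((ε k : ℤ) : ℝ) := by
  induction n with
  | zero =>
    have : ∀ x : Fin 0 → ℝ, F x = F 0 := fun x => by rw [Subsingleton.elim x 0]
    simp_rw [this]
    simp
  | succ n ih =>
    have hcons : ∀ t, (fun k : Fin (n + 1) => Rademacher k t) =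
        Fin.cons (Rademacher 0 t) fun k : Fin n => Rademacher k (2 * t) := fun t => by
      funext k
      refine Fin.cases rfl (fun k => ?_) k
      simp [← rademacher_succ]
    have hcoe : ∀ (u : ℤˣ) (ε : Fin n → ℤˣ),
        (fun k => (((Fin.cons u ε : Fin (n + 1) → ℤˣ) k : ℤ) : ℝ)) =
          Fin.cons ((u : ℤ) : ℝ) fun k => ((ε k : ℤ) : ℝ) := fun u ε => by
      funext k
      refine Fin.cases rfl (fun k => rfl) k
    obtain ⟨i1, e1⟩ := ih fun y => F (Fin.cons 1 y)
    obtain ⟨i2, e2⟩ := ih fun y => F (Fin.cons (-1) y)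
    have c1 : Set.EqOn (fun t => F (Fin.cons 1 fun k : Fin n => Rademacher k (2 * t)))
        (fun t => F fun k => Rademacher k t) (Set.uIoo 0 (1/2)) := fun t ht => by
      rw [Set.uIoo_of_le (by norm_num)] at ht
      simp only [hcons, rademacher_zero_of_lt ht.1 ht.2]
    have c2 : Set.EqOn (fun t => F (Fin.cons (-1) fun k : Fin n => Rademacher k (2 * t - 1)))
        (fun t => F fun k => Rademacher k t) (Set.uIoo (1/2) 1) := fun t ht => by
      rw [Set.uIoo_of_le (by norm_num)] at ht
      simp only [hcons, rademacher_zero_of_gt ht.1 ht.2, rademacher_sub_one]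
    have j1 : IntervalIntegrable (fun t => F fun k => Rademacher k t) volume 0 (1/2) := by
      have := i1.comp_mul_left (c := 2)
      rw [zero_div] at this
      exact this.congr_uIoo c1
    have j2 : IntervalIntegrable (fun t => F fun k => Rademacher k t) volume (1/2) 1 := by
      have := (i2.comp_sub_right 1).comp_mul_left (c := 2)
      norm_num at this
      exact this.congr_uIoo (by simpa using c2)
    refine ⟨j1.trans j2, ?_⟩
    rw [← intervalIntegral.integral_add_adjacent_intervals j1 j2, ← intervalIntegral.integral_congr_uIoo c1,
      ← intervalIntegral.integral_congr_uIoo c2,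
      intervalIntegral.integral_comp_mul_left
        (fun t => F (Fin.cons 1 fun k : Fin n => Rademacher k t)) two_ne_zero,
      intervalIntegral.integral_comp_mul_sub
        (fun t => F (Fin.cons (-1) fun k : Fin n => Rademacher k t)) two_ne_zero, expect_signs_succ]
    norm_num [hcoe]
    rw [e1, e2]

variable {E : Type*} [NormedAddCommGroup E] [NormedSpace ℝ E]

lemma integral_norm_sq_rademacher {n : ℕ} (x : Fin n → E) :
    ∫ t in (0:ℝ)..1, ‖∑ k : Fin n, Rademacher k.1 t • x k‖ ^ 2 = radSq x :=
  (integral_rademacher fun y : Fin n → ℝ => ‖∑ k, y k • x k‖ ^ 2).2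

lemma hasCotype_iff {q : ℝ} : HasCotype q E ↔ 2 ≤ q ∧ ∃ C > 0, ∀ (n : ℕ) (x : Fin n → E),
    (∑ k, ‖x k‖ ^ q) ^ (1 / q) ≤ C * √(radSq x) := by
  simp only [HasCotype, integral_norm_sq_rademacher, Real.sqrt_eq_rpow]

/-- A space of cotype `q` controls mean squares of families indexed by any finite type. -/
lemma HasCotype.expect_sq_le {q : ℝ} (h : HasCotype q E) : ∃ C : ℝ, 0 < C ∧
    ∀ (K : ℕ) [NeZero K] (y : ZMod K → E),
      𝔼 s, ‖y s‖ ^ 2 ≤ (C * (K : ℝ) ^ (-(1 / q))) ^ 2 * radSq y := by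
  obtain ⟨hq, C, hC, H⟩ := hasCotype_iff.1 h
  refine ⟨C, hC, fun K _ y => ?_⟩
  have hK : (0:ℝ) < K := by exact_mod_cast Nat.pos_of_ne_zero (NeZero.ne K)
  have hq0 : 0 < q := by linarith
  have h1 := H _ (y ∘ (Fintype.equivFin (ZMod K)).symm)
  have e1 : ∑ k, ‖(y ∘ (Fintype.equivFin (ZMod K)).symm) k‖ ^ q = ∑ s, ‖y s‖ ^ q :=
    Fintype.sum_equiv (Fintype.equivFin (ZMod K)).symm _ _ fun _ => rfl
  rw [radSq_comp_equiv, e1] at h1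
  have h2 : 𝔼 s, ‖y s‖ ^ 2 ≤ (𝔼 s, ‖y s‖ ^ q) ^ (2 / q) := by
    have := Real.rpow_arith_mean_le_arith_mean_rpow Finset.univ (fun _ : ZMod K => (1 / K : ℝ))
      (fun s => ‖y s‖ ^ 2) (fun _ _ => by positivity) (by simp [hK.ne']) (fun _ _ => by positivity)
      (p := q / 2) (by linarith)
    simp_rw [← Finset.mul_sum, ← Real.rpow_natCast, ← Real.rpow_mul (norm_nonneg _)] at this
    rw [show ((2:ℕ):ℝ) * (q / 2) = q by push_cast; ring] at this
    simp_rw [Fintype.expect_eq_sum_div_card, ZMod.card, ← Real.rpow_natCast]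
    rw [div_eq_mul_one_div, mul_comm, div_eq_mul_one_div (∑ s, ‖y s‖ ^ q), mul_comm (∑ s, ‖y s‖ ^ q)]
    refine le_trans (le_of_eq ?_) (Real.rpow_le_rpow (by positivity) this
      (by positivity : (0:ℝ) ≤ 2 / q))
    rw [← Real.rpow_mul (by positivity), show q / 2 * (2 / q) = 1 by field_simp, Real.rpow_one]
  refine h2.trans ?_
  have hS : 0 ≤ ∑ s, ‖y s‖ ^ q := by positivity
  calc (𝔼 s, ‖y s‖ ^ q) ^ (2 / q) = ((K : ℝ) ^ (-(1 / q)) * (∑ s, ‖y s‖ ^ q) ^ (1 / q)) ^ 2 := by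
        rw [Fintype.expect_eq_sum_div_card, ZMod.card, div_eq_inv_mul, ← Real.rpow_neg_one,
          Real.mul_rpow (by positivity) hS, ← Real.rpow_mul hK.le, mul_pow, ← Real.rpow_natCast,
          ← Real.rpow_natCast, ← Real.rpow_mul hK.le, ← Real.rpow_mul hS]
        congr 2 <;> push_cast <;> ring
    _ ≤ ((K : ℝ) ^ (-(1 / q)) * (C * √(radSq y))) ^ 2 := by gcongr
    _ = _ := by
        rw [mul_pow, mul_pow, Real.sq_sqrt (radSq_nonneg _)]; ring

end RademacherIntegral

section Summing

variable {E : Type*} [NormedAddCommGroup E] [NormedSpace ℝ E]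

lemma exists_signs_sum_abs_eq {ι : Type*} [Fintype ι] (f : E →L[ℝ] ℝ) (x : ι → E) :
    ∃ ε : ι → ℤˣ, f (signSum ε x) = ∑ i, |f (x i)| := by
  have : ∀ i, ∃ u : ℤˣ, ((u : ℤ) : ℝ) * f (x i) = |f (x i)| := fun i => by
    rcases abs_cases (f (x i)) with ⟨h, -⟩ | ⟨h, -⟩
    · exact ⟨1, by simp [h]⟩
    · exact ⟨-1, by simp [h]⟩
  choose ε hε using this
  exact ⟨ε, by rw [map_signSum]; exact Finset.sum_congr rfl fun i _ => hε i⟩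

lemma signSum_smul {ι : Type*} [Fintype ι] (ε : ι → ℤˣ) (c : ℝ) (x : ι → E) :
    signSum ε (c • x) = c • signSum ε x := by
  simp only [signSum, Finset.smul_sum, Pi.smul_apply, smul_comm c]

lemma radSq_smul {ι : Type*} [Fintype ι] [DecidableEq ι] (c : ℝ) (x : ι → E) :
    radSq (c • x) = c ^ 2 * radSq x := by
  simp only [radSq, signSum_smul, norm_smul, mul_pow, Finset.mul_expect, Real.norm_eq_abs, sq_abs]

lemma radSq_le_sq {ι : Type*} [Fintype ι] [DecidableEq ι] {x : ι → E} {B : ℝ}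
    (h : ∀ ε : ι → ℤˣ, ‖signSum ε x‖ ≤ B) : radSq x ≤ B ^ 2 :=
  Finset.expect_le Finset.univ_nonempty fun ε _ => by gcongr; exact h ε

/-- Extension by zero of a finite family to a sequence. -/
def extendZero {M : Type*} [Zero M] {n : ℕ} (y : Fin n → M) (i : ℕ) : M :=
  if h : i < n then y ⟨i, h⟩ else 0

lemma hasSum_extendZero {M : Type*} [Zero M] {n : ℕ} (y : Fin n → M) (g : M → ℝ) (hg : g 0 = 0) :
    HasSum (fun i => g (extendZero y i)) (∑ i, g (y i)) := by
  rw [← Function.Injective.hasSum_iff (Fin.val_injective (n := n))]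
  · convert hasSum_fintype (fun i => g (y i)) using 2
    simp [extendZero]
  · intro i hi
    have : ¬ i < n := fun h => hi ⟨⟨i, h⟩, rfl⟩
    simp [extendZero, this, hg]

/-- The finite form of the `(a,1)`-summing property. -/
lemma AbsolutelySumming.exists_bound {a : ℝ} (ha : 1 ≤ a)
    (h : AbsolutelySumming a 1 (ContinuousLinearMap.id ℝ E)) :
    ∃ C > 0, ∀ (n : ℕ) (x : Fin n → E) (B : ℝ), (∀ ε : Fin n → ℤˣ, ‖signSum ε x‖ ≤ B) →
      (∑ i, ‖x i‖ ^ a) ^ (1 / a) ≤ C * B := by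
  have ha0 : 0 < a := by linarith
  by_contra! hc
  have key : ∀ k : ℕ, ∃ (n : ℕ) (y : Fin n → E),
      (∀ ε : Fin n → ℤˣ, ‖signSum ε y‖ ≤ (1 / 2) ^ k) ∧ ∑ i, ‖y i‖ ^ a = 1 := by
    intro k
    obtain ⟨n, x, B, hB, hlt⟩ := hc (2 ^ k) (by positivity)
    have hB0 : 0 ≤ B := (norm_nonneg _).trans (hB 1)
    set S := (∑ i, ‖x i‖ ^ a) ^ (1 / a)
    have hS : 0 < S := lt_of_le_of_lt (by positivity) hlt
    refine ⟨n, S⁻¹ • x, fun ε => ?_, ?_⟩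
    · rw [signSum_smul, norm_smul, norm_inv, Real.norm_of_nonneg hS.le, inv_mul_le_iff₀ hS, one_div,
        inv_pow, ← div_eq_mul_inv, le_div_iff₀ (by positivity)]
      nlinarith [hB ε, pow_pos (two_pos (α := ℝ)) k]
    · have hSa : S ^ a = ∑ i, ‖x i‖ ^ a := by
        rw [← Real.rpow_mul (by positivity), one_div_mul_cancel ha0.ne', Real.rpow_one]
      simp only [Pi.smul_apply, norm_smul, norm_inv, Real.norm_of_nonneg hS.le]
      simp_rw [Real.mul_rpow (inv_nonneg.2 hS.le) (norm_nonneg _), ← Finset.mul_sum, ← hSa,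
        Real.inv_rpow hS.le]
      exact inv_mul_cancel₀ (Real.rpow_pos_of_pos hS a).ne'
  choose n y hy1 hy2 using key
  let Y : ℕ × ℕ → E := fun p => extendZero (y p.1) p.2
  have hweak : WeaklySummable 1 (Y ∘ Nat.pairEquiv.symm) := by
    intro φ
    have hs : Summable fun p => |φ (Y p)| := by
      rw [summable_prod_of_nonneg fun p => abs_nonneg _]
      refine ⟨fun k => (hasSum_extendZero (y k) (fun v => |φ v|) (by simp)).summable, ?_⟩
      refine Summable.of_nonneg_of_le (fun k => tsum_nonneg fun _ => abs_nonneg _) (fun k => ?_)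
        (summable_geometric_two.mul_left ‖φ‖)
      rw [(hasSum_extendZero (y k) (fun v => |φ v|) (by simp)).tsum_eq]
      obtain ⟨ε, hε⟩ := exists_signs_sum_abs_eq φ (y k)
      rw [← hε]
      exact (le_abs_self _).trans ((φ.le_opNorm _).trans (by gcongr; exact hy1 k ε))
    simp only [Real.rpow_one]
    exact (Nat.pairEquiv.symm.summable_iff (f := fun p => |φ (Y p)|)).2 hs
  have hs := h _ hweak
  have hs' : Summable fun p => ‖Y p‖ ^ a :=
    (Nat.pairEquiv.symm.summable_iff (f := fun p => ‖Y p‖ ^ a)).1 hs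
  rw [summable_prod_of_nonneg fun p => by positivity] at hs'
  have h1 := hs'.2
  have : ∀ k, ∑' i, ‖Y (k, i)‖ ^ a = 1 := fun k => by
    rw [(hasSum_extendZero (y k) (fun v => ‖v‖ ^ a) (by simp [ha0.ne'])).tsum_eq, hy2]
  simp_rw [this] at h1
  exact one_ne_zero ((summable_const_iff (1 : ℝ)).1 h1)

lemma WeaklySummable.exists_bound {x : ℕ → E} (hx : WeaklySummable 1 x) :
    ∃ B, ∀ (n : ℕ) (ε : Fin n → ℤˣ), ‖signSum ε fun i => x i‖ ≤ B := by
  let v : (Σ n : ℕ, Fin n → ℤˣ) → E := fun p => signSum p.2 fun i => x i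
  obtain ⟨B, hB⟩ := banach_steinhaus
    (g := fun p => NormedSpace.inclusionInDoubleDual ℝ E (v p)) fun φ => by
      refine ⟨∑' j, |φ (x j)|, fun p => ?_⟩
      have hs : Summable fun j => |φ (x j)| := by simpa using hx φ
      have h1 : |φ (v p)| ≤ ∑ i : Fin p.1, |φ (x i)| := by
        rw [map_signSum]
        refine (Finset.abs_sum_le_sum_abs _ _).trans (le_of_eq ?_)
        simp only [abs_mul, abs_coe_units, one_mul]
      refine le_trans (by simpa using h1) ?_
      rw [Fin.sum_univ_eq_sum_range fun j => |φ (x j)|]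
      exact hs.sum_le_tsum _ fun _ _ => abs_nonneg _
  refine ⟨B, fun n ε => ?_⟩
  rw [← (NormedSpace.inclusionInDoubleDualLi ℝ).norm_map]
  exact hB ⟨n, ε⟩

lemma HasCotype.absolutelySumming {q : ℝ} (h : HasCotype q E) :
    AbsolutelySumming q 1 (ContinuousLinearMap.id ℝ E) := by
  obtain ⟨hq, C, hC, H⟩ := hasCotype_iff.1 h
  have hq0 : 0 < q := by linarith
  intro x hx
  obtain ⟨B, hB⟩ := hx.exists_bound
  have hB0 : 0 ≤ B := (norm_nonneg _).trans (hB 0 1)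
  refine summable_of_sum_range_le (c := (C * B) ^ q) (fun j => by positivity) fun n => ?_
  have h1 := H n fun i => x i
  have h2 : √(radSq fun i : Fin n => x i) ≤ B := Real.sqrt_le_iff.2 ⟨hB0, radSq_le_sq (hB n)⟩
  rw [Fin.sum_univ_eq_sum_range fun j => ‖x j‖ ^ q] at h1
  have h3 := Real.rpow_le_rpow (by positivity) (h1.trans (by gcongr : _ ≤ C * B)) hq0.le
  rwa [← Real.rpow_mul (by positivity), one_div_mul_cancel hq0.ne', Real.rpow_one] at h3

end Summing

section EqualNorm

variable {E : Type*} [NormedAddCommGroup E] [NormedSpace ℝ E]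

lemma card_level_rpow_le {w C : ℝ}
    (H : ∀ (n : ℕ) (x : Fin n → E), (∀ i, 1 / 2 < ‖x i‖ ∧ ‖x i‖ ≤ 1) →
      (n : ℝ) ^ w ≤ C * √(radSq x)) (hC : 0 ≤ C)
    {n : ℕ} {y : Fin n → E} (hy : radSq y ≤ 1) (k : ℕ) :
    ((Finset.univ.filter fun i => (1 / 2 : ℝ) ^ (k + 1) < ‖y i‖ ∧ ‖y i‖ ≤ (1 / 2) ^ k).card : ℝ) ^ w
      ≤ C * 2 ^ k := by
  set A := Finset.univ.filter fun i => (1 / 2 : ℝ) ^ (k + 1) < ‖y i‖ ∧ ‖y i‖ ≤ (1 / 2) ^ k with hA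
  have hk : (2 : ℝ) ^ k * (1 / 2) ^ k = 1 := by rw [← mul_pow]; norm_num
  have hpos : (0 : ℝ) < 2 ^ k := by positivity
  have h := H A.card ((2 : ℝ) ^ k • (y ∘ A.orderEmbOfFin rfl)) fun i => by
    have hi := (Finset.mem_filter.1 (A.orderEmbOfFin_mem rfl i)).2
    simp only [Pi.smul_apply, Function.comp_apply, norm_smul, norm_pow, Real.norm_ofNat]
    rw [pow_succ] at hi
    constructor <;> nlinarith [hi.1, hi.2]
  refine h.trans ?_
  rw [radSq_smul, Real.sqrt_mul (by positivity), Real.sqrt_sq hpos.le]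
  have h1 : √(radSq (y ∘ A.orderEmbOfFin rfl)) ≤ 1 :=
    Real.sqrt_le_one.2 ((radSq_comp_le (A.orderEmbOfFin rfl).injective y).trans hy)
  gcongr
  exact mul_le_of_le_one_right hpos.le h1

/-- A lower estimate for Rademacher averages of vectors of comparable norms gives cotype. -/
lemma hasCotype_of_comparable_norm {w q C : ℝ} (hw : 0 < w) (hq : 2 ≤ q) (hwq : 1 / w < q)
    (hC : 0 ≤ C)
    (H : ∀ (n : ℕ) (x : Fin n → E), (∀ i, 1 / 2 < ‖x i‖ ∧ ‖x i‖ ≤ 1) →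
      (n : ℝ) ^ w ≤ C * √(radSq x)) : HasCotype q E := by
  have hq0 : 0 < q := by linarith
  set ρ : ℝ := 2 ^ (1 / w - q) with hρ
  have hρ0 : 0 ≤ ρ := by positivity
  have hρ1 : ρ < 1 := Real.rpow_lt_one_of_one_lt_of_neg one_lt_two (by linarith)
  set D : ℝ := C ^ (1 / w) * (1 - ρ)⁻¹
  have hD0 : 0 ≤ D := mul_nonneg (by positivity) (inv_nonneg.2 (by linarith))
  have key : ∀ (n : ℕ) (y : Fin n → E), radSq y ≤ 1 → ∑ i, ‖y i‖ ^ q ≤ D := by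
    intro n y hy
    have hlev : ∀ i, ∃ k : ℕ, y i ≠ 0 → (1 / 2 : ℝ) ^ (k + 1) < ‖y i‖ ∧ ‖y i‖ ≤ (1 / 2) ^ k := by
      intro i
      by_cases h0 : y i = 0
      · exact ⟨0, fun h => absurd h0 h⟩
      · have h1 : ‖y i‖ ≤ 1 := by
          nlinarith [sq_norm_le_radSq y i, norm_nonneg (y i)]
        obtain ⟨k, hk⟩ := exists_nat_pow_near_of_lt_one (norm_pos_iff.2 h0) h1
          (by norm_num : (0 : ℝ) < 1 / 2) (by norm_num)
        exact ⟨k, fun _ => hk⟩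
    choose lev hlev using hlev
    let b : ℕ → ℝ := fun k => ((1 / 2 : ℝ) ^ k) ^ q
    have hb : ∀ k, 0 ≤ b k := fun k => by positivity
    calc ∑ i, ‖y i‖ ^ q
        ≤ ∑ i, ∑ k ∈ Finset.univ.image lev,
            if (1 / 2 : ℝ) ^ (k + 1) < ‖y i‖ ∧ ‖y i‖ ≤ (1 / 2) ^ k then b k else 0 := by
          refine Finset.sum_le_sum fun i _ => ?_
          by_cases h0 : y i = 0
          · rw [h0, norm_zero, Real.zero_rpow hq0.ne']
            exact Finset.sum_nonneg fun k _ => by split_ifs <;> simp [hb]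
          · refine le_trans ?_ (Finset.single_le_sum (fun k _ => ?_)
              (Finset.mem_image_of_mem lev (Finset.mem_univ i)))
            · rw [if_pos (hlev i h0)]
              exact Real.rpow_le_rpow (norm_nonneg _) (hlev i h0).2 hq0.le
            · split_ifs <;> simp [hb]
      _ ≤ ∑ k ∈ Finset.univ.image lev, C ^ (1 / w) * ρ ^ k := by
          rw [Finset.sum_comm]
          refine Finset.sum_le_sum fun k _ => ?_
          rw [← Finset.sum_filter, Finset.sum_const, nsmul_eq_mul]
          have h1 := Real.rpow_le_rpow (by positivity) (card_level_rpow_le H hC hy k)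
            (one_div_nonneg.2 hw.le)
          rw [← Real.rpow_mul (by positivity), mul_one_div_cancel hw.ne', Real.rpow_one,
            Real.mul_rpow hC (by positivity)] at h1
          refine (mul_le_mul_of_nonneg_right h1 (hb k)).trans (le_of_eq ?_)
          rw [mul_assoc]
          congr 1
          simp only [b, hρ]
          rw [one_div (2 : ℝ), inv_pow, Real.inv_rpow (by positivity), ← Real.rpow_natCast,
            ← Real.rpow_mul two_pos.le, ← Real.rpow_mul two_pos.le, ← Real.rpow_natCast,
            ← Real.rpow_mul two_pos.le, ← Real.rpow_neg two_pos.le, ← Real.rpow_add two_pos]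
          congr 1
          ring
      _ ≤ ∑' k : ℕ, C ^ (1 / w) * ρ ^ k :=
          ((summable_geometric_of_lt_one hρ0 hρ1).mul_left _).sum_le_tsum _
            fun k _ => by positivity
      _ = D := by rw [tsum_mul_left, tsum_geometric_of_lt_one hρ0 hρ1]
  refine hasCotype_iff.2 ⟨hq, D ^ (1 / q) + 1, by positivity, fun n x => ?_⟩
  rcases (Real.sqrt_nonneg (radSq x)).eq_or_lt' with h0 | h0
  · have hx : ∀ i, x i = 0 := fun i => by
      have := sq_norm_le_radSq x i
      rw [(Real.sqrt_eq_zero (radSq_nonneg x)).1 h0] at this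
      exact norm_eq_zero.1 (pow_eq_zero_iff two_ne_zero |>.1 (this.antisymm (sq_nonneg _)))
    simp [hx, h0, hq0.ne']
  · set R := √(radSq x)
    have h1 := key n (R⁻¹ • x) (by
      rw [radSq_smul, ← Real.sq_sqrt (radSq_nonneg x), ← mul_pow, inv_mul_cancel₀ h0.ne', one_pow])
    simp only [Pi.smul_apply, norm_smul, norm_inv, Real.norm_of_nonneg h0.le] at h1
    simp_rw [Real.mul_rpow (inv_nonneg.2 h0.le) (norm_nonneg _), ← Finset.mul_sum,
      Real.inv_rpow h0.le] at h1
    rw [inv_mul_le_iff₀ (by positivity)] at h1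
    have h2 := Real.rpow_le_rpow (by positivity) h1 (one_div_nonneg.2 hq0.le)
    rw [Real.mul_rpow (by positivity) hD0, ← Real.rpow_mul h0.le, mul_one_div_cancel hq0.ne',
      Real.rpow_one] at h2
    nlinarith

end EqualNorm

section MainEstimate

variable {E : Type*} [NormedAddCommGroup E] [NormedSpace ℝ E]

/-- Block sizes used for the transversal argument. -/
lemma exists_block_sizes {n : ℕ} (hn : 1 ≤ n) {β : ℝ} (hβ0 : 0 ≤ β) (hβ1 : β ≤ 1) :
    ∃ m K : ℕ, 0 < K ∧ m * K ≤ n ∧ (n : ℝ) ^ β / 2 ≤ K ∧ (n : ℝ) ^ (1 - β) / 2 ≤ m := by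
  have hn1 : (1 : ℝ) ≤ n := by exact_mod_cast hn
  have hn0 : (0 : ℝ) < n := by linarith
  have h1 : 1 ≤ (n : ℝ) ^ β := Real.one_le_rpow hn1 hβ0
  set K := ⌊(n : ℝ) ^ β⌋₊ with hK
  have hK1 : 1 ≤ K := Nat.one_le_floor_iff _ |>.2 h1
  have hK2 : (K : ℝ) ≤ (n : ℝ) ^ β := Nat.floor_le (by positivity)
  have hKn : K ≤ n := by
    have : (n : ℝ) ^ β ≤ (n : ℝ) ^ (1 : ℝ) := Real.rpow_le_rpow_of_exponent_le hn1 hβ1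
    rw [Real.rpow_one] at this
    exact_mod_cast hK2.trans this
  refine ⟨n / K, K, hK1, Nat.div_mul_le_self n K, ?_, ?_⟩
  · have h2 : (n : ℝ) ^ β < K + 1 := Nat.lt_floor_add_one _
    have h3 : (1 : ℝ) ≤ K := by exact_mod_cast hK1
    linarith
  · have hm1 : 1 ≤ n / K := (Nat.one_le_div_iff hK1).2 hKn
    have h2 : n < (n / K + 1) * K := by
      rw [mul_comm]; exact Nat.lt_mul_div_succ n hK1
    have h3 : n ≤ 2 * (n / K) * K := h2.le.trans (Nat.mul_le_mul_right K (by omega))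
    have h4 : (n : ℝ) ≤ 2 * (n / K : ℕ) * K := by exact_mod_cast h3
    have h5 : (n : ℝ) ^ (1 - β) * (n : ℝ) ^ β = n := by
      rw [← Real.rpow_add hn0, sub_add_cancel, Real.rpow_one]
    have h6 : (n : ℝ) ^ (1 - β) * (n : ℝ) ^ β ≤ 2 * (n / K : ℕ) * (n : ℝ) ^ β := by
      rw [h5]; exact h4.trans (by gcongr)
    have h7 := le_of_mul_le_mul_right h6 (by positivity)
    linarith

lemma rpow_le_sqrt_radSq {a r β w A C : ℝ} (ha : 1 ≤ a) (hA : 0 ≤ A) (hC : 0 ≤ C) (hr : 0 ≤ r)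
    (hβ0 : 0 ≤ β) (hβ1 : β ≤ 1) (hw : 0 < w) (h1 : w + (1 / 2 - β) ≤ (1 - β) / a)
    (h2 : w - β * r ≤ (1 - β) / a)
    (hsum : ∀ (n : ℕ) (x : Fin n → E) (B : ℝ), (∀ ε : Fin n → ℤˣ, ‖signSum ε x‖ ≤ B) →
      (∑ i, ‖x i‖ ^ a) ^ (1 / a) ≤ A * B)
    (havg : ∀ (K : ℕ) [NeZero K] (y : ZMod K → E),
      Finset.expect Finset.univ (fun s => ‖y s‖ ^ 2) ≤ (C * (K : ℝ) ^ (-r)) ^ 2 * radSq y)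
    (n : ℕ) (x : Fin n → E) (hx : ∀ i, 1 / 2 < ‖x i‖) :
    (n : ℝ) ^ w ≤ 4 * A * (2 + 2 * C * 2 ^ r) * √(radSq x) := by
  have ha0 : 0 < a := by linarith
  rcases Nat.eq_zero_or_pos n with rfl | hn
  · rw [Nat.cast_zero, Real.zero_rpow hw.ne']
    positivity
  have hn1 : (1 : ℝ) ≤ n := by exact_mod_cast hn
  have hn0 : (0 : ℝ) < n := by linarith
  obtain ⟨m, K, hK, hmK, hKβ, hmβ⟩ := exists_block_sizes hn hβ0 hβ1
  have : NeZero K := ⟨hK.ne'⟩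
  have hK0 : (0 : ℝ) < K := by exact_mod_cast hK
  obtain ⟨e⟩ := Function.Embedding.nonempty_of_card_le (α := Fin m × ZMod K) (β := Fin n)
    (by simpa [ZMod.card] using hmK)
  set R := √(radSq x)
  obtain ⟨κ, hκ⟩ := exists_transversal (sq_nonneg _) (havg K) (x ∘ e)
  rw [Real.sqrt_sq (by positivity), ZMod.card] at hκ
  have hsqrt : √(m : ℝ) / √(K : ℝ) ≤ 2 * (n : ℝ) ^ (1 / 2 - β) := by
    rw [← Real.sqrt_div (Nat.cast_nonneg m)]
    refine Real.sqrt_le_iff.2 ⟨by positivity, ?_⟩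
    rw [div_le_iff₀ hK0]
    have h3 : ((n : ℝ) ^ (1 / 2 - β)) ^ 2 * ((n : ℝ) ^ β) ^ 2 = n := by
      rw [← mul_pow, ← Real.rpow_add hn0, sub_add_cancel, ← Real.sqrt_eq_rpow, Real.sq_sqrt hn0.le]
    have h4 : (m : ℝ) * K ≤ n := by exact_mod_cast hmK
    have h5 : ((n : ℝ) ^ β) ^ 2 ≤ (2 * K) ^ 2 := by gcongr; linarith
    have h6 : (m : ℝ) * K ≤ (2 * (n : ℝ) ^ (1 / 2 - β)) ^ 2 * K * K := by
      refine (h4.trans h3.symm.le).trans ?_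
      exact (mul_le_mul_of_nonneg_left h5 (by positivity)).trans (le_of_eq (by ring))
    exact le_of_mul_le_mul_right h6 hK0
  have hKr : (K : ℝ) ^ (-r) ≤ 2 ^ r * (n : ℝ) ^ (-(β * r)) := by
    calc (K : ℝ) ^ (-r) ≤ ((n : ℝ) ^ β / 2) ^ (-r) :=
          Real.rpow_le_rpow_of_nonpos (by positivity) hKβ (by linarith)
      _ = 2 ^ r * (n : ℝ) ^ (-(β * r)) := by
          rw [Real.div_rpow (by positivity) two_pos.le, ← Real.rpow_mul hn0.le,
            Real.rpow_neg two_pos.le, div_inv_eq_mul, mul_comm, mul_neg]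
  have hB := hsum m (fun i => x (e (i, κ i)))
    ((2 * (n : ℝ) ^ (1 / 2 - β) + 2 * (C * (2 ^ r * (n : ℝ) ^ (-(β * r))))) * R) fun ε =>
      (hκ ε).trans (by
        have := Real.sqrt_le_sqrt (radSq_comp_le e.injective x)
        gcongr)
  have hlow : (n : ℝ) ^ ((1 - β) / a) / 4 ≤ (∑ i, ‖x (e (i, κ i))‖ ^ a) ^ (1 / a) := by
    have h3 : (n : ℝ) ^ (1 - β) / 2 * (1 / 2) ^ a ≤ ∑ i, ‖x (e (i, κ i))‖ ^ a := by
      calc (n : ℝ) ^ (1 - β) / 2 * (1 / 2) ^ a ≤ m * (1 / 2) ^ a := by gcongr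
        _ = ∑ i : Fin m, (1 / 2 : ℝ) ^ a := by simp
        _ ≤ _ := Finset.sum_le_sum fun i _ =>
          Real.rpow_le_rpow (by norm_num) (hx _).le ha0.le
    refine le_trans ?_ (Real.rpow_le_rpow (by positivity) h3 (one_div_nonneg.2 ha0.le))
    rw [Real.mul_rpow (by positivity) (by positivity), ← Real.rpow_mul (by norm_num : (0:ℝ) ≤ 1 / 2),
      mul_one_div_cancel ha0.ne', Real.rpow_one, Real.div_rpow (by positivity) two_pos.le,
      ← Real.rpow_mul hn0.le, mul_one_div, mul_one_div (1 - β)]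
    have h4 : (2 : ℝ) ^ (1 / a) ≤ 2 := by
      have := Real.rpow_le_rpow_of_exponent_le one_le_two ((div_le_one ha0).2 ha)
      rwa [Real.rpow_one] at this
    have h5 : (n : ℝ) ^ ((1 - β) / a) / 2 ≤ (n : ℝ) ^ ((1 - β) / a) / 2 ^ (1 / a) := by gcongr
    linarith
  set t := (1 - β) / a
  have e1 : (n : ℝ) ^ w = (n : ℝ) ^ t * (n : ℝ) ^ (w - t) := by
    rw [← Real.rpow_add hn0]; congr 1; ring
  have e2 : (n : ℝ) ^ (1 / 2 - β) * (n : ℝ) ^ (w - t) ≤ 1 := by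
    rw [← Real.rpow_add hn0]
    exact Real.rpow_le_one_of_one_le_of_nonpos hn1 (by linarith)
  have e3 : (n : ℝ) ^ (-(β * r)) * (n : ℝ) ^ (w - t) ≤ 1 := by
    rw [← Real.rpow_add hn0]
    exact Real.rpow_le_one_of_one_le_of_nonpos hn1 (by linarith)
  have hR : 0 ≤ R := Real.sqrt_nonneg _
  calc (n : ℝ) ^ w = 4 * ((n : ℝ) ^ t / 4) * (n : ℝ) ^ (w - t) := by rw [e1]; ring
    _ ≤ 4 * (A * ((2 * (n : ℝ) ^ (1 / 2 - β) + 2 * (C * (2 ^ r * (n : ℝ) ^ (-(β * r))))) * R)) *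
          (n : ℝ) ^ (w - t) := by gcongr; exact hlow.trans hB
    _ = 4 * A * (2 * ((n : ℝ) ^ (1 / 2 - β) * (n : ℝ) ^ (w - t)) +
          2 * C * 2 ^ r * ((n : ℝ) ^ (-(β * r)) * (n : ℝ) ^ (w - t))) * R := by ring
    _ ≤ 4 * A * (2 * 1 + 2 * C * 2 ^ r * 1) * R := by gcongr
    _ = 4 * A * (2 + 2 * C * 2 ^ r) * R := by ring

end MainEstimate

section DvoretzkyRogers

open Module

lemma det_eq_two_pow_finrank {M : Type*} [AddCommGroup M] [Module ℝ M] [FiniteDimensional ℝ M]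
    {V W : Submodule ℝ M} (h : IsCompl V W) (T : M →ₗ[ℝ] M) (hV : ∀ v ∈ V, T v = v)
    (hW : ∀ w ∈ W, T w = (2 : ℝ) • w) : LinearMap.det T = 2 ^ finrank ℝ W := by
  let e := V.prodEquivOfIsCompl W h
  have hT : T = e.toLinearMap ∘ₗ
      (LinearMap.prodMap LinearMap.id ((2 : ℝ) • LinearMap.id)) ∘ₗ e.symm.toLinearMap := by
    ext x
    obtain ⟨⟨v, w⟩, rfl⟩ := e.surjective x
    simp [e, hV v v.2, hW w w.2]
  rw [hT, LinearMap.det_conj, LinearMap.det_prodMap, LinearMap.det_id, LinearMap.det_smul,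
    LinearMap.det_id, one_mul, mul_one]

/-- Lewis' lemma in the form needed for the Dvoretzky–Rogers theorem: a contraction of maximal
determinant is not small on subspaces of large dimension. -/
lemma exists_contraction_norm_ge {F : Type*} [NormedAddCommGroup F] [NormedSpace ℝ F]
    [FiniteDimensional ℝ F] {n : ℕ} (hn : 0 < n) (hF : finrank ℝ F = n) :
    ∃ u : EuclideanSpace ℝ (Fin n) →L[ℝ] F, ‖u‖ ≤ 1 ∧
      ∀ V : Submodule ℝ (EuclideanSpace ℝ (Fin n)), 2 * finrank ℝ V ≤ n →
        ∃ f ∈ Vᗮ, ‖f‖ = 1 ∧ 2 / 5 ≤ ‖u f‖ := by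
  let H := EuclideanSpace ℝ (Fin n)
  let L : F ≃L[ℝ] H := ContinuousLinearEquiv.ofFinrankEq (by simp [H, hF])
  let δ : (H →L[ℝ] F) → ℝ := fun u => |((L : F →L[ℝ] H).comp u).det|
  have hδ : Continuous δ := (ContinuousLinearMap.continuous_det.comp
    (ContinuousLinearMap.compL ℝ H F H (L : F →L[ℝ] H)).continuous).abs
  have : ProperSpace (H →L[ℝ] F) := FiniteDimensional.proper ℝ _
  obtain ⟨u, hu, hmax⟩ := (isCompact_closedBall (0 : H →L[ℝ] F) 1).exists_isMaxOn
    ⟨0, by simp⟩ hδ.continuousOn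
  have hu1 : ‖u‖ ≤ 1 := by simpa using hu
  have hsmul : ∀ (c : ℝ) (v : H →L[ℝ] F), δ (c • v) = |c| ^ n * δ v := fun c v => by
    simp only [δ, ContinuousLinearMap.comp_smul, ContinuousLinearMap.det,
      ContinuousLinearMap.toLinearMap_smul, LinearMap.det_smul, abs_mul, abs_pow]
    simp [H]
  have hpos : 0 < δ u := by
    have h1 : δ (L.symm : H →L[ℝ] F) = 1 := by simp [δ, ContinuousLinearMap.det]
    set c : ℝ := (1 + ‖(L.symm : H →L[ℝ] F)‖)⁻¹
    have hc : 0 < c := by positivity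
    have h2 : c • (L.symm : H →L[ℝ] F) ∈ Metric.closedBall (0 : H →L[ℝ] F) 1 := by
      rw [mem_closedBall_zero_iff, norm_smul, Real.norm_of_nonneg hc.le,
        inv_mul_le_iff₀ (by positivity)]
      linarith
    have h3 : δ (c • (L.symm : H →L[ℝ] F)) ≤ δ u := hmax h2
    rw [hsmul, h1] at h3
    exact lt_of_lt_of_le (by positivity) h3
  refine ⟨u, hu1, fun V hV => ?_⟩
  by_contra! hc
  have hsmall : ∀ f ∈ Vᗮ, ‖u f‖ ≤ 2 / 5 * ‖f‖ := fun f hf => by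
    rcases eq_or_ne f 0 with rfl | h0
    · simp
    · have h1 := (hc (‖f‖⁻¹ • f) (Vᗮ.smul_mem _ hf) (norm_smul_inv_norm h0)).le
      rwa [map_smul, norm_smul, norm_inv, norm_norm, inv_mul_le_iff₀ (norm_pos_iff.2 h0),
        mul_comm] at h1
  let T : H →L[ℝ] H := ContinuousLinearMap.id ℝ H + Vᗮ.starProjection
  have hdetT : T.det = 2 ^ finrank ℝ Vᗮ := by
    refine det_eq_two_pow_finrank V.isCompl_orthogonal (T : H →ₗ[ℝ] H) (fun v hv => ?_)
      fun w hw => ?_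
    · have : Vᗮ.starProjection v = 0 :=
        (Submodule.starProjection_apply_eq_zero_iff _).2 (Submodule.le_orthogonal_orthogonal V hv)
      simp [T, this]
    · have : Vᗮ.starProjection w = w := Submodule.starProjection_eq_self_iff.2 hw
      simp [T, this, two_smul]
  have huT : ‖u.comp T‖ ≤ 7 / 5 := ContinuousLinearMap.opNorm_le_bound _ (by norm_num) fun h => by
    have h1 : ‖u h‖ ≤ ‖h‖ := (u.le_opNorm h).trans (mul_le_of_le_one_left (norm_nonneg _) hu1)
    have h2 := hsmall _ (Vᗮ.starProjection_apply_mem h)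
    have h3 := Vᗮ.norm_starProjection_apply_le h
    have h4 : ‖(u.comp T) h‖ ≤ ‖u h‖ + ‖u (Vᗮ.starProjection h)‖ := by
      simpa [T] using norm_add_le (u h) (u (Vᗮ.starProjection h))
    linarith
  have hmem : (5 / 7 : ℝ) • u.comp T ∈ Metric.closedBall (0 : H →L[ℝ] F) 1 := by
    rw [mem_closedBall_zero_iff, norm_smul, Real.norm_of_nonneg (by norm_num)]
    linarith
  have h1 : δ ((5 / 7 : ℝ) • u.comp T) ≤ δ u := hmax hmem
  have h2 : δ (u.comp T) = δ u * 2 ^ finrank ℝ Vᗮ := by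
    have : ((L : F →L[ℝ] H).comp (u.comp T)).det = ((L : F →L[ℝ] H).comp u).det * T.det := by
      simp only [ContinuousLinearMap.det, ← LinearMap.det_comp]
      rfl
    simp only [δ, this, hdetT, abs_mul]
    simp
  rw [hsmul, h2, abs_of_pos (by norm_num), mul_left_comm] at h1
  have h3 : (5 / 7 : ℝ) ^ n * 2 ^ finrank ℝ Vᗮ ≤ 1 := by
    by_contra! h
    nlinarith
  have hdim : finrank ℝ V + finrank ℝ Vᗮ = n := by
    rw [V.finrank_add_finrank_orthogonal]; simp
  set d := finrank ℝ Vᗮ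
  have h4 : (5 / 7 : ℝ) ^ (2 * d) ≤ (5 / 7) ^ n :=
    pow_le_pow_of_le_one (by norm_num) (by norm_num) (by omega)
  have h5 : (1 : ℝ) < ((5 / 7) ^ 2 * 2) ^ d := one_lt_pow₀ (by norm_num) (by omega)
  rw [mul_pow, ← pow_mul] at h5
  have h6 : (5 / 7 : ℝ) ^ (2 * d) * 2 ^ d ≤ (5 / 7) ^ n * 2 ^ d := by gcongr
  linarith

lemma exists_orthonormal_of_forall_submodule {H : Type*} [NormedAddCommGroup H]
    [InnerProductSpace ℝ H] {m : ℕ} {p : H → Prop}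
    (hp : ∀ V : Submodule ℝ H, finrank ℝ V < m → ∃ f ∈ Vᗮ, ‖f‖ = 1 ∧ p f) :
    ∀ k ≤ m, ∃ f : Fin k → H, Orthonormal ℝ f ∧ ∀ i, p (f i) := by
  intro k
  induction k with
  | zero => exact fun _ => ⟨Fin.elim0, ⟨fun i => i.elim0, fun i => i.elim0⟩, fun i => i.elim0⟩
  | succ k ih =>
    intro hk
    obtain ⟨f, hf, hpf⟩ := ih (by omega)
    obtain ⟨g, hg, hg1, hpg⟩ := hp (Submodule.span ℝ (Set.range f)) (by
      rw [finrank_span_eq_card hf.linearIndependent, Fintype.card_fin]; omega)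
    have hgf : ∀ i, inner ℝ (f i) g = 0 := fun i =>
      (Submodule.mem_orthogonal _ _).1 hg _ (Submodule.subset_span ⟨i, rfl⟩)
    refine ⟨Fin.cons g f, ⟨fun i => ?_, fun i j hij => ?_⟩, fun i => ?_⟩
    · refine Fin.cases ?_ (fun i => ?_) i
      · simpa using hg1
      · simpa using hf.1 i
    · revert hij
      refine Fin.cases ?_ (fun i => ?_) i <;> refine Fin.cases ?_ (fun j => ?_) j
      · simp
      · intro _
        simpa [real_inner_comm] using hgf j
      · intro _
        simpa using hgf i
      · intro hij
        simpa using hf.2 fun h => hij (by rw [h])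
    · refine Fin.cases ?_ (fun i => ?_) i
      · simpa using hpg
      · simpa using hpf i

variable {E : Type*} [NormedAddCommGroup E] [NormedSpace ℝ E]

/-- The Dvoretzky–Rogers lemma. -/
lemma exists_norm_signSum_le_sqrt (hE : ¬ FiniteDimensional ℝ E) {m : ℕ} (hm : 0 < m) :
    ∃ x : Fin m → E, (∀ i, 2 / 5 ≤ ‖x i‖) ∧ ∀ ε : Fin m → ℤˣ, ‖signSum ε x‖ ≤ √m := by
  obtain ⟨s, hs, hli⟩ := (le_rank_iff_exists_linearIndependent_finset (n := 2 * m)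
    (K := ℝ) (V := E)).1 (Cardinal.natCast_lt_aleph0.le.trans
      (not_lt.1 fun h => hE (rank_lt_aleph0_iff.1 h)))
  let F := Submodule.span ℝ (s : Set E)
  have : FiniteDimensional ℝ F := FiniteDimensional.span_finset ℝ s
  obtain ⟨u, hu, hV⟩ := exists_contraction_norm_ge (F := F) (n := 2 * m) (by omega)
    ((finrank_span_finset_eq_card hli).trans hs)
  obtain ⟨f, hf, hfu⟩ := exists_orthonormal_of_forall_submodule (m := m)
    (p := fun f => 2 / 5 ≤ ‖u f‖) (fun V hVm => hV V (by omega)) m le_rfl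
  refine ⟨fun i => (u (f i) : E), hfu, fun ε => ?_⟩
  have h1 : signSum ε (fun i => (u (f i) : E)) = (u (signSum ε f) : E) := by
    simp [signSum]
  have h2 : ‖signSum ε f‖ = √m := by
    rw [eq_comm, Real.sqrt_eq_iff_mul_self_eq (by positivity) (norm_nonneg _), ← sq,
      ← real_inner_self_eq_norm_sq, signSum, hf.inner_sum]
    have h3 : ∀ i, ((ε i : ℤ) : ℝ) * ((ε i : ℤ) : ℝ) = 1 := fun i => by
      rw [← abs_mul_abs_self, abs_coe_units, one_mul]
    simp [h3]
  rw [h1, ← h2]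
  exact (u.le_opNorm _).trans (mul_le_of_le_one_left (norm_nonneg _) hu)

lemma AbsolutelySumming.two_le (hE : ¬ FiniteDimensional ℝ E) {a : ℝ} (ha : 1 ≤ a)
    (h : AbsolutelySumming a 1 (ContinuousLinearMap.id ℝ E)) : 2 ≤ a := by
  obtain ⟨C, hC, H⟩ := h.exists_bound ha
  by_contra! ha2
  have ha0 : 0 < a := by linarith
  have hle : ∀ m : ℕ, 0 < m → (m : ℝ) ^ (1 / a - 1 / 2) ≤ C / (2 / 5) := by
    intro m hm
    have hm0 : (0 : ℝ) < m := by exact_mod_cast hm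
    obtain ⟨x, hx1, hx2⟩ := exists_norm_signSum_le_sqrt hE hm
    have h1 : (m : ℝ) * (2 / 5) ^ a ≤ ∑ i, ‖x i‖ ^ a := by
      calc (m : ℝ) * (2 / 5) ^ a = ∑ i : Fin m, (2 / 5 : ℝ) ^ a := by simp
        _ ≤ _ := Finset.sum_le_sum fun i _ => Real.rpow_le_rpow (by norm_num) (hx1 i) ha0.le
    have h2 := (Real.rpow_le_rpow (by positivity) h1 (one_div_nonneg.2 ha0.le)).trans
      (H m x _ hx2)
    rw [Real.mul_rpow hm0.le (by positivity), ← Real.rpow_mul (by norm_num),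
      mul_one_div_cancel ha0.ne', Real.rpow_one] at h2
    rw [Real.rpow_sub hm0, ← Real.sqrt_eq_rpow, div_le_div_iff₀ (by positivity) (by norm_num)]
    exact h2
  have hlim : Filter.Tendsto (fun m : ℕ => (m : ℝ) ^ (1 / a - 1 / 2)) Filter.atTop Filter.atTop :=
    (tendsto_rpow_atTop (sub_pos.2 (one_div_lt_one_div_of_lt ha0 ha2))).comp
      tendsto_natCast_atTop_atTop
  obtain ⟨m, hm0, hm⟩ := ((Filter.eventually_gt_atTop 0).and
    (hlim.eventually_gt_atTop (C / (2 / 5)))).exists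
  exact absurd (hle m hm0) (not_le.2 hm)

end DvoretzkyRogers

section MaureyPisier

variable {E : Type*} [NormedAddCommGroup E] [NormedSpace ℝ E]

lemma AbsolutelySumming.exists_hasCotype {a s : ℝ} (ha : 2 ≤ a)
    (h : AbsolutelySumming a 1 (ContinuousLinearMap.id ℝ E)) (hs0 : 0 ≤ s) (hsa : s < 1 / a)
    (havg : ∀ η > 0, ∃ r ≥ 0, s - η ≤ r ∧ ∃ C ≥ 0, ∀ (K : ℕ) [NeZero K] (y : ZMod K → E),
      Finset.expect Finset.univ (fun i => ‖y i‖ ^ 2) ≤ (C * (K : ℝ) ^ (-r)) ^ 2 * radSq y) :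
    ∃ q, HasCotype q E ∧ s < 1 / q := by
  have ha2 : 1 / a ≤ 1 / 2 := one_div_le_one_div_of_le two_pos ha
  set β : ℝ := 1 / (2 * (1 - s)) with hβ
  have hβs : β * (1 - s) = 1 / 2 := by
    rw [hβ]; field_simp [show 1 - s ≠ 0 by linarith]
  have hβ0 : 0 ≤ β := one_div_nonneg.2 (by linarith)
  have hβ1 : β < 1 := by
    rw [hβ, div_lt_one (by linarith)]; linarith
  set δ : ℝ := (1 - β) * (1 / a - s) with hδ
  have hδ0 : 0 < δ := mul_pos (by linarith) (by linarith)
  have hδ1 : δ ≤ 1 / a - s := mul_le_of_le_one_left (by linarith) (by linarith)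
  have hdiv : (1 - β) / a = (1 - β) * s + δ := by rw [hδ]; ring
  obtain ⟨A, hA, hsum⟩ := h.exists_bound (by linarith)
  obtain ⟨r, hr0, hr, C, hC, hCavg⟩ := havg (δ / 2) (by linarith)
  have hw := rpow_le_sqrt_radSq (w := s + δ / 2) (by linarith : 1 ≤ a) hA.le hC hr0 hβ0 hβ1.le
    (by linarith) (by rw [hdiv]; linarith)
    (by rw [hdiv]; nlinarith [mul_le_mul_of_nonneg_left hr hβ0]) hsum hCavg
  refine ⟨1 / (s + δ / 4), hasCotype_of_comparable_norm (w := s + δ / 2) (by linarith) ?_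
    (one_div_lt_one_div_of_lt (by linarith) (by linarith)) (by positivity)
    fun n x hx => hw n x fun i => (hx i).1, ?_⟩
  · rw [le_div_iff₀ (by linarith)]; linarith
  · rw [one_div_one_div]; linarith

lemma cot_le_of_absolutelySumming {a : ℝ} (ha : 2 ≤ a)
    (h : AbsolutelySumming a 1 (ContinuousLinearMap.id ℝ E)) : cot E ≤ ENNReal.ofReal a := by
  have hle : ∀ q, HasCotype q E → cot E ≤ ENNReal.ofReal q := fun q hq => sInf_le ⟨q, hq, rfl⟩
  by_contra! hlt
  rcases eq_or_ne (cot E) ∞ with htop | htop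
  · obtain ⟨q, hq, -⟩ := h.exists_hasCotype ha le_rfl (by positivity) fun η hη =>
      ⟨0, le_rfl, by linarith, 1, zero_le_one, fun K _ y => by
        simpa using Finset.expect_le Finset.univ_nonempty fun i _ => sq_norm_le_radSq y i⟩
    exact absurd (hle q hq) (by simp [htop])
  · set q₀ := (cot E).toReal with hq₀
    have hcot : cot E = ENNReal.ofReal q₀ := (ENNReal.ofReal_toReal htop).symm
    have haq : a < q₀ := (ENNReal.ofReal_lt_iff_lt_toReal (by linarith) htop).1 hlt
    have hle' : ∀ q, HasCotype q E → q₀ ≤ q := fun q hq =>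
      ENNReal.toReal_le_of_le_ofReal (by linarith [hq.1]) (hle q hq)
    obtain ⟨q, hq, hlt'⟩ := h.exists_hasCotype (s := 1 / q₀) ha
      (one_div_nonneg.2 (by linarith)) (one_div_lt_one_div_of_lt (by linarith) haq) fun η hη => by
        have h1 : cot E < ENNReal.ofReal (q₀ + η) := by
          rw [hcot]; exact (ENNReal.ofReal_lt_ofReal_iff (by linarith)).2 (by linarith)
        obtain ⟨_, ⟨q, hq, rfl⟩, hqη⟩ := sInf_lt_iff.1 h1
        have h2 : q < q₀ + η := (ENNReal.ofReal_lt_ofReal_iff (by linarith)).1 hqη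
        have h3 := hle' q hq
        obtain ⟨C, hC, H⟩ := hq.expect_sq_le
        refine ⟨1 / q, one_div_nonneg.2 (by linarith), ?_, C, hC.le, H⟩
        have h4 : 1 / q₀ - 1 / q = (q - q₀) / (q₀ * q) := by
          field_simp [show q₀ ≠ 0 by linarith, show q ≠ 0 by linarith]
        have h5 : (q - q₀) / (q₀ * q) ≤ η := by
          have h6 : 1 ≤ q₀ * q := by nlinarith
          rw [div_le_iff₀ (by linarith)]
          nlinarith [mul_le_mul_of_nonneg_left h6 hη.le]
        linarith
    exact absurd (one_div_le_one_div_of_le (by linarith) (hle' q hq)) (not_le.2 hlt')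

end MaureyPisier

/-- Maurey–Pisier:
`cot E = inf{a ≥ 1 : id_E is absolutely (a,1)-summing}`, both sides possibly `∞`. -/
theorem stmt15 (E : Type*) [NormedAddCommGroup E] [NormedSpace ℝ E] [CompleteSpace E]
    (hE : ¬ FiniteDimensional ℝ E) :
    cot E = sInf {c : ℝ≥0∞ | ∃ a : ℝ, 1 ≤ a ∧
      AbsolutelySumming a 1 (ContinuousLinearMap.id ℝ E) ∧ c = ENNReal.ofReal a} := by
  refine le_antisymm (le_sInf ?_) (le_sInf ?_)
  · rintro _ ⟨a, ha, h, rfl⟩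
    exact cot_le_of_absolutelySumming (h.two_le hE ha) h
  · rintro _ ⟨q, hq, rfl⟩
    exact sInf_le ⟨q, by linarith [hq.1], hq.absolutelySumming, rfl⟩

end
end

section
/- (Dvoretzky–Rogers) Let E be an infinite dimensional Banach space and 1 ≤ p ≤ q < ∞ with 1/p − 1/q < 1/2. Then the identity map id_E : E → E is not absolutely (q,p)-summing. -/
open scoped ENNReal NNReal BigOperators ZeroAtInfty

noncomputable section

open Module in
theorem det_id_add_starProjection {H : Type*} [NormedAddCommGroup H] [InnerProductSpace ℝ H]
    [FiniteDimensional ℝ H] (W : Submodule ℝ H) :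
    (ContinuousLinearMap.id ℝ H + W.starProjection).det = 2 ^ finrank ℝ W := by
  let f : H →ₗ[ℝ] H := (ContinuousLinearMap.id ℝ H + W.starProjection : H →L[ℝ] H)
  let e := W.prodEquivOfIsCompl _ W.isCompl_orthogonal
  have hf : e.symm.toLinearMap ∘ₗ f ∘ₗ e.symm.symm.toLinearMap =
      LinearMap.prodMap ((2 : ℝ) • LinearMap.id) LinearMap.id := by
    refine LinearMap.ext fun x => e.injective ?_
    have h1 : W.starProjection (x.1 : H) = x.1 :=
      Submodule.starProjection_eq_self_iff.2 x.1.2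
    have h2 : W.starProjection (x.2 : H) = 0 :=
      W.starProjection_apply_eq_zero_iff.2 x.2.2
    simp only [LinearMap.comp_apply, LinearEquiv.coe_coe, LinearEquiv.apply_symm_apply,
      LinearEquiv.symm_symm]
    simp [f, e, h1, h2, two_smul]
    abel
  change LinearMap.det f = _
  rw [← LinearMap.det_conj f e.symm, hf, LinearMap.det_prodMap]
  simp

/-- An extremal position: a linear image of Euclidean space in which determinants are controlled
by operator norms. -/
theorem exists_det_extremal {H E : Type*} [NormedAddCommGroup H] [InnerProductSpace ℝ H]
    [FiniteDimensional ℝ H] [NormedAddCommGroup E] [NormedSpace ℝ E] (ι : H →L[ℝ] E)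
    (hι : Function.Injective ι) :
    ∃ A : H →L[ℝ] H, ‖ι ∘L A‖ ≤ 1 ∧ 0 < |A.det| ∧
      ∀ (B : H →L[ℝ] H) (c : ℝ), 0 < c → ‖ι ∘L B‖ ≤ c →
        |B.det| ≤ c ^ Module.finrank ℝ H * |A.det| := by
  obtain ⟨K, -, hK⟩ := LinearMap.exists_antilipschitzWith (ι : H →ₗ[ℝ] E)
    (LinearMap.ker_eq_bot.2 hι)
  let S : Set (H →L[ℝ] H) := {A | ‖ι ∘L A‖ ≤ 1}
  have hcont : Continuous fun A : H →L[ℝ] H => ι ∘L A :=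
    (ContinuousLinearMap.compL ℝ H H E ι).continuous
  have hclosed : IsClosed S := isClosed_le hcont.norm continuous_const
  have hbdd : Bornology.IsBounded S := by
    refine (isBounded_iff_forall_norm_le).2 ⟨K, fun A hA => ?_⟩
    refine ContinuousLinearMap.opNorm_le_bound _ K.2 fun x => ?_
    have h1 := hK.le_mul_dist (A x) 0
    have h2 : ‖ι (A x)‖ ≤ ‖x‖ := by
      simpa using (ι ∘L A).le_of_opNorm_le hA x
    simp only [map_zero, dist_zero_right] at h1
    exact h1.trans (mul_le_mul_of_nonneg_left h2 K.2)
  have hcpt : IsCompact S := Metric.isCompact_of_isClosed_isBounded hclosed hbdd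
  obtain ⟨A, hA, hmax⟩ := hcpt.exists_isMaxOn ⟨0, by simp [S]⟩
    (ContinuousLinearMap.continuous_det.abs.continuousOn (s := S))
  have hscale : ∀ (B : H →L[ℝ] H) (c : ℝ), 0 < c → ‖ι ∘L B‖ ≤ c →
      |B.det| ≤ c ^ Module.finrank ℝ H * |A.det| := by
    intro B c hc hB
    have hmem : c⁻¹ • B ∈ S := by
      change ‖ι ∘L (c⁻¹ • B)‖ ≤ 1
      rw [ContinuousLinearMap.comp_smul, norm_smul, norm_inv, Real.norm_of_nonneg hc.le,
        inv_mul_le_iff₀ hc, mul_one]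
      exact hB
    have h1 : |(c⁻¹ • B).det| ≤ |A.det| := hmax hmem
    have h2 : (c⁻¹ • B).det = c⁻¹ ^ Module.finrank ℝ H * B.det := by
      simp [ContinuousLinearMap.det, LinearMap.det_smul]
    rwa [h2, abs_mul, abs_of_pos (by positivity), inv_pow, inv_mul_le_iff₀ (by positivity)] at h1
  refine ⟨A, hA, ?_, hscale⟩
  have h1 := hscale (ContinuousLinearMap.id ℝ H) (‖ι‖ + 1) (by positivity) (by simp)
  have h2 : (ContinuousLinearMap.id ℝ H).det = 1 := by simp [ContinuousLinearMap.det]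
  rw [h2, abs_one] at h1
  exact pos_of_mul_pos_right (zero_lt_one.trans_le h1) (by positivity)

/-- In extremal position, every subspace of at least half the dimension contains a unit vector
whose image has norm at least `1 / 3`. -/
theorem exists_unit_vector_of_det_extremal {H E : Type*} [NormedAddCommGroup H]
    [InnerProductSpace ℝ H] [FiniteDimensional ℝ H] [NormedAddCommGroup E] [NormedSpace ℝ E]
    {ι : H →L[ℝ] E} {A : H →L[ℝ] H} (hA : ‖ι ∘L A‖ ≤ 1) (hdet : 0 < |A.det|)
    (hmax : ∀ (B : H →L[ℝ] H) (c : ℝ), 0 < c → ‖ι ∘L B‖ ≤ c →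
      |B.det| ≤ c ^ Module.finrank ℝ H * |A.det|)
    (W : Submodule ℝ H) (hH : 0 < Module.finrank ℝ H)
    (hW : Module.finrank ℝ H ≤ 2 * Module.finrank ℝ W) :
    ∃ y ∈ W, ‖y‖ = 1 ∧ 1 / 3 ≤ ‖ι (A y)‖ := by
  by_contra! hcon
  have hsmall : ∀ w ∈ W, ‖ι (A w)‖ ≤ 1 / 3 * ‖w‖ := by
    intro w hw
    rcases eq_or_ne w 0 with rfl | hw0
    · simp
    have hpos : 0 < ‖w‖ := norm_pos_iff.2 hw0
    have h1 := hcon (‖w‖⁻¹ • w) (W.smul_mem _ hw) (by simp [norm_smul, hpos.ne'])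
    rw [map_smul, map_smul, norm_smul, norm_inv, norm_norm, inv_mul_lt_iff₀ hpos] at h1
    linarith
  have hnorm : ‖ι ∘L (A ∘L (ContinuousLinearMap.id ℝ H + W.starProjection))‖ ≤ 4 / 3 := by
    refine ContinuousLinearMap.opNorm_le_bound _ (by norm_num) fun x => ?_
    have h1 : ‖ι (A x)‖ ≤ ‖x‖ := by simpa using (ι ∘L A).le_of_opNorm_le hA x
    have h2 := hsmall (W.starProjection x) (W.starProjection_apply_mem x)
    have h3 : ‖W.starProjection x‖ ≤ ‖x‖ := W.norm_starProjection_apply_le x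
    have h4 := norm_add_le (ι (A x)) (ι (A (W.starProjection x)))
    simp only [ContinuousLinearMap.comp_apply, add_apply,
      ContinuousLinearMap.id_apply, map_add]
    linarith
  have h1 := hmax _ _ (by norm_num) hnorm
  have h2 : (A ∘L (ContinuousLinearMap.id ℝ H + W.starProjection)).det =
      A.det * 2 ^ Module.finrank ℝ W := by
    rw [← det_id_add_starProjection W]
    exact LinearMap.det_comp _ _
  rw [h2, abs_mul, mul_comm, mul_le_mul_iff_left₀ hdet, abs_of_pos (by positivity)] at h1
  set n := Module.finrank ℝ H
  have h3 : (2 : ℝ) ^ n ≤ (16 / 9) ^ n := by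
    calc (2 : ℝ) ^ n ≤ 2 ^ (2 * Module.finrank ℝ W) := pow_le_pow_right₀ (by norm_num) hW
      _ = (2 ^ Module.finrank ℝ W) ^ 2 := by rw [mul_comm, pow_mul]
      _ ≤ ((4 / 3) ^ n) ^ 2 := by gcongr
      _ = (16 / 9) ^ n := by rw [← pow_mul, mul_comm, pow_mul]; norm_num
  exact absurd h3 (not_le.2 (pow_lt_pow_left₀ (by norm_num) (by norm_num) hH.ne'))

theorem Orthonormal.finSnoc {H : Type*} [NormedAddCommGroup H] [InnerProductSpace ℝ H] {n : ℕ}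
    {v : Fin n → H} (hv : Orthonormal ℝ v) {y : H} (hy : ‖y‖ = 1)
    (hvy : y ∈ (Submodule.span ℝ (Set.range v))ᗮ) :
    Orthonormal ℝ (Fin.snoc v y : Fin (n + 1) → H) := by
  have h0 : ∀ i, inner ℝ (v i) y = 0 := fun i =>
    (Submodule.mem_orthogonal _ _).1 hvy _ (Submodule.subset_span ⟨i, rfl⟩)
  constructor
  · intro i
    refine Fin.lastCases ?_ (fun i => ?_) i
    · simpa using hy
    · simpa using hv.1 i
  · intro i j
    refine Fin.lastCases ?_ (fun i => ?_) i <;> refine Fin.lastCases ?_ (fun j => ?_) j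
    · simp
    · intro _
      simpa [real_inner_comm] using h0 j
    · intro _
      simpa using h0 i
    · intro hij
      simpa using hv.2 fun h => hij (by rw [h])

/-- The Dvoretzky–Rogers lemma: an infinite dimensional normed space contains, for each `n`,
`n` vectors of norm at least `1 / 3` whose weak `ℓ₂`-norm is at most `1`. -/
theorem exists_norm_ge_sum_sq_le {E : Type*} [NormedAddCommGroup E] [NormedSpace ℝ E]
    (hE : ¬ FiniteDimensional ℝ E) (n : ℕ) :
    ∃ x : Fin n → E, (∀ i, 1 / 3 ≤ ‖x i‖) ∧
      ∀ φ : E →L[ℝ] ℝ, ∑ i, |φ (x i)| ^ 2 ≤ ‖φ‖ ^ 2 := by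
  rcases Nat.eq_zero_or_pos n with rfl | hn
  · exact ⟨0, fun i => i.elim0, fun φ => by simp⟩
  let H := EuclideanSpace ℝ (Fin (2 * n))
  have hdim : Module.finrank ℝ H = 2 * n := by simp [H]
  obtain ⟨w, hw⟩ : ∃ w : Fin (2 * n) → E, LinearIndependent ℝ w := by
    have h1 : ((2 * n : ℕ) : Cardinal) ≤ Module.rank ℝ E :=
      (Cardinal.natCast_lt_aleph0.le).trans
        (not_lt.1 fun h => hE (Module.rank_lt_aleph0_iff.1 h))
    exact exists_linearIndependent_of_le_rank h1
  let ι : H →L[ℝ] E := LinearMap.toContinuousLinearMap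
    ((Fintype.linearCombination ℝ w) ∘ₗ (WithLp.linearEquiv 2 ℝ (Fin (2 * n) → ℝ)).toLinearMap)
  have hι : Function.Injective ι :=
    hw.fintypeLinearCombination_injective.comp (WithLp.linearEquiv 2 ℝ _).injective
  obtain ⟨A, hA, hdet, hmax⟩ := exists_det_extremal ι hι
  have key : ∀ j ≤ n, ∃ v : Fin j → H, Orthonormal ℝ v ∧ ∀ i, 1 / 3 ≤ ‖ι (A (v i))‖ := by
    intro j
    induction j with
    | zero => exact fun _ => ⟨Fin.elim0, ⟨fun i => i.elim0, fun i => i.elim0⟩, fun i => i.elim0⟩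
    | succ j ih =>
      intro hj
      obtain ⟨v, hv, hv3⟩ := ih (by omega)
      have h1 := (Submodule.span ℝ (Set.range v)).finrank_add_finrank_orthogonal
      rw [finrank_span_eq_card hv.linearIndependent, Fintype.card_fin] at h1
      obtain ⟨y, hy, hy1, hy3⟩ := exists_unit_vector_of_det_extremal hA hdet hmax
        (Submodule.span ℝ (Set.range v))ᗮ (by omega) (by omega)
      refine ⟨Fin.snoc v y, hv.finSnoc hy1 hy, fun i => ?_⟩
      refine Fin.lastCases ?_ (fun i => ?_) i
      · simpa using hy3
      · simpa using hv3 i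
  obtain ⟨v, hv, hv3⟩ := key n le_rfl
  refine ⟨fun i => ι (A (v i)), hv3, fun φ => ?_⟩
  let ψ : H →L[ℝ] ℝ := φ ∘L (ι ∘L A)
  have hψ : ‖ψ‖ ≤ ‖φ‖ :=
    (ContinuousLinearMap.opNorm_comp_le _ _).trans (mul_le_of_le_one_right (norm_nonneg _) hA)
  let z := (InnerProductSpace.toDual ℝ H).symm ψ
  have hz : ∀ x, φ (ι (A x)) = inner ℝ z x := fun x => by
    simp [z, ψ]
  have hz2 : ‖z‖ = ‖ψ‖ := LinearIsometryEquiv.norm_map _ _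
  calc ∑ i, |φ (ι (A (v i)))| ^ 2 = ∑ i, ‖inner ℝ (v i) z‖ ^ 2 := by
        simp only [hz, Real.norm_eq_abs, real_inner_comm]
    _ ≤ ‖z‖ ^ 2 := hv.sum_inner_products_le z
    _ ≤ ‖φ‖ ^ 2 := by rw [hz2]; gcongr

theorem sum_rpow_le_of_sum_sq_le {n : ℕ} {p C : ℝ} (hp : 1 ≤ p) (hC : 0 ≤ C) {a : Fin n → ℝ}
    (ha : ∑ i, |a i| ^ 2 ≤ C ^ 2) :
    ∑ i, |a i| ^ p ≤ (n : ℝ) ^ max 0 (1 - p / 2) * C ^ p := by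
  have hp0 : 0 < p := by linarith
  rcases le_total p 2 with h2 | h2
  · rw [max_eq_right (by linarith)]
    have h3 := Real.rpow_sum_le_const_mul_sum_rpow Finset.univ (fun i => |a i| ^ p)
      (p := 2 / p) ((one_le_div hp0).2 h2)
    have h4 : ∀ i, |(|a i| ^ p)| ^ (2 / p) = |a i| ^ 2 := fun i => by
      rw [abs_of_nonneg (by positivity), ← Real.rpow_mul (abs_nonneg _),
        mul_div_cancel₀ _ hp0.ne', Real.rpow_two]
    simp only [h4, Finset.card_univ, Fintype.card_fin] at h3
    simp only [abs_of_nonneg (Real.rpow_nonneg (abs_nonneg _) p)] at h3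
    have h5 : 0 ≤ ∑ i, |a i| ^ p := Finset.sum_nonneg fun i _ => by positivity
    have h6 := Real.rpow_le_rpow (by positivity)
      (h3.trans (mul_le_mul_of_nonneg_left ha (by positivity))) (by positivity : 0 ≤ p / 2)
    rw [← Real.rpow_mul h5, Real.mul_rpow (by positivity) (by positivity),
      ← Real.rpow_mul (by positivity), ← Real.rpow_natCast, ← Real.rpow_mul hC] at h6
    have e1 : 2 / p * (p / 2) = 1 := by field_simp
    have e2 : (2 / p - 1) * (p / 2) = 1 - p / 2 := by field_simp
    have e3 : ((2 : ℕ) : ℝ) * (p / 2) = p := by push_cast; ring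
    rwa [e1, e2, e3, Real.rpow_one] at h6
  · rw [max_eq_left (by linarith), Real.rpow_zero, one_mul]
    have hle : ∀ i, |a i| ≤ C := fun i =>
      (sq_le_sq₀ (abs_nonneg _) hC).1 ((Finset.single_le_sum (f := fun i => |a i| ^ 2)
        (fun j _ => by positivity) (Finset.mem_univ i)).trans ha)
    have hsplit : ∀ b : ℝ, 0 ≤ b → b ^ p = b ^ (p - 2) * b ^ 2 := fun b hb => by
      rw [← Real.rpow_two, ← Real.rpow_add_of_nonneg hb (by linarith) (by norm_num),
        sub_add_cancel]
    calc ∑ i, |a i| ^ p ≤ ∑ i, C ^ (p - 2) * |a i| ^ 2 := by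
          refine Finset.sum_le_sum fun i _ => ?_
          rw [hsplit _ (abs_nonneg _)]
          gcongr
          exact hle i
      _ = C ^ (p - 2) * ∑ i, |a i| ^ 2 := by rw [Finset.mul_sum]
      _ ≤ C ^ (p - 2) * C ^ 2 := by gcongr
      _ = C ^ p := (hsplit C hC).symm

/-- Dvoretzky–Rogers: if `1 ≤ p ≤ q < ∞` and `1/p − 1/q < 1/2`, then `id_E`
is not absolutely `(q,p)`-summing on an infinite dimensional Banach space. -/
theorem stmt16 (E : Type*) [NormedAddCommGroup E] [NormedSpace ℝ E] [CompleteSpace E]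
    (hE : ¬ FiniteDimensional ℝ E) (p q : ℝ) (hp : 1 ≤ p) (hpq : p ≤ q)
    (h : 1 / p - 1 / q < 1 / 2) :
    ¬ AbsolutelySumming q p (ContinuousLinearMap.id ℝ E) := by
  intro hsum
  have hp0 : 0 < p := by linarith
  have hq0 : 0 < q := by linarith
  choose x hx3 hx2 using fun k : ℕ => exists_norm_ge_sum_sq_le hE (2 ^ k)
  let s : ℕ → ℝ := fun k => ((2 : ℝ) ^ k) ^ (-(1 / q))
  have hs0 : ∀ k, 0 < s k := fun k => by positivity
  let X : (Σ k : ℕ, Fin (2 ^ k)) → E := fun j => s j.1 • x j.1 j.2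
  have : Infinite (Σ k : ℕ, Fin (2 ^ k)) :=
    Infinite.of_injective (fun k => ⟨k, ⟨0, by positivity⟩⟩) fun a b hab => congrArg Sigma.fst hab
  obtain ⟨e⟩ : Nonempty (ℕ ≃ Σ k : ℕ, Fin (2 ^ k)) := by
    obtain ⟨d⟩ := nonempty_denumerable (Σ k : ℕ, Fin (2 ^ k))
    exact ⟨(Denumerable.eqv _).symm⟩
  have hweak : WeaklySummable p (X ∘ e) := by
    intro φ
    refine (e.summable_iff (f := fun j => |φ (X j)| ^ p)).2 ?_
    refine (summable_sigma_of_nonneg fun j => by positivity).2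
      ⟨fun k => (hasSum_fintype _).summable, ?_⟩
    simp only [tsum_fintype]
    set r : ℝ := 2 ^ (max 0 (1 - p / 2) - p / q) with hr
    have hr1 : r < 1 := by
      refine Real.rpow_lt_one_of_one_lt_of_neg (by norm_num) ?_
      rw [sub_neg, max_lt_iff]
      refine ⟨by positivity, ?_⟩
      have := mul_lt_mul_of_pos_left h hp0
      have e1 : p * (1 / p - 1 / q) = 1 - p / q := by field_simp
      linarith
    refine Summable.of_nonneg_of_le (fun k => Finset.sum_nonneg fun i _ => by positivity)
      (fun k => ?_) ((summable_geometric_of_lt_one (by positivity) hr1).mul_right (‖φ‖ ^ p))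
    have h1 := sum_rpow_le_of_sum_sq_le hp (norm_nonneg φ) (hx2 k φ)
    have h2 : s k ^ p * ((2 : ℝ) ^ k) ^ max 0 (1 - p / 2) = r ^ k := by
      have h2k : (0 : ℝ) < 2 ^ k := by positivity
      rw [hr, ← Real.rpow_mul h2k.le, ← Real.rpow_add h2k, Real.rpow_pow_comm (by norm_num)]
      congr 1
      ring
    calc ∑ i, |φ (X ⟨k, i⟩)| ^ p = s k ^ p * ∑ i, |φ (x k i)| ^ p := by
          rw [Finset.mul_sum]
          refine Finset.sum_congr rfl fun i _ => ?_
          simp only [X, map_smul, smul_eq_mul, abs_mul, abs_of_pos (hs0 k)]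
          rw [Real.mul_rpow (hs0 k).le (abs_nonneg _)]
      _ ≤ s k ^ p * (((2 ^ k : ℕ) : ℝ) ^ max 0 (1 - p / 2) * ‖φ‖ ^ p) := by gcongr
      _ = r ^ k * ‖φ‖ ^ p := by rw [← mul_assoc]; push_cast; rw [h2]
  have hX := (e.summable_iff (f := fun j => ‖X j‖ ^ q)).1 (hsum _ hweak)
  have hlim := ((summable_sigma_of_nonneg fun j => by positivity).1 hX).2.tendsto_atTop_zero
  simp only [tsum_fintype] at hlim
  have hlow : ∀ k, (1 / 3 : ℝ) ^ q ≤ ∑ i, ‖X ⟨k, i⟩‖ ^ q := by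
    intro k
    have hsq : s k ^ q = ((2 : ℝ) ^ k)⁻¹ := by
      rw [← Real.rpow_mul (by positivity), neg_mul, one_div_mul_cancel hq0.ne', Real.rpow_neg_one]
    calc (1 / 3 : ℝ) ^ q = ∑ _i : Fin (2 ^ k), s k ^ q * (1 / 3 : ℝ) ^ q := by
          rw [hsq, Finset.sum_const, Finset.card_univ, Fintype.card_fin, nsmul_eq_mul]
          push_cast
          field_simp
      _ ≤ ∑ i, ‖X ⟨k, i⟩‖ ^ q := by
          refine Finset.sum_le_sum fun i _ => ?_
          rw [norm_smul, Real.norm_of_nonneg (hs0 k).le,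
            Real.mul_rpow (hs0 k).le (norm_nonneg _)]
          gcongr
          exact hx3 k i
  exact absurd (ge_of_tendsto' hlim hlow) (not_le.2 (by positivity))

end
end

section
/- (Diestel–Jarchow–Tonge, cotype q > 2 case) Let E and F be Banach spaces where E has cotype q for some 2 < q < ∞, and let 1 < r < q*. Then a continuous linear operator u : E → F is absolutely (r,r)-summing if and only if it is absolutely (1,1)-summing. -/
open scoped ENNReal NNReal BigOperators ZeroAtInfty

noncomputable section

section Helpers

variable {E F : Type*} [NormedAddCommGroup E] [NormedSpace ℝ E]
  [NormedAddCommGroup F] [NormedSpace ℝ F]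

/-- The weak `ℓ_p` norm of a weakly `p`-summable sequence is finite. -/
theorem WeaklySummable.exists_bound_s18 {p : ℝ} (hp : 1 ≤ p) {x : ℕ → E} (hx : WeaklySummable p x) :
    ∃ W > 0, ∀ (s : Finset ℕ) (φ : E →L[ℝ] ℝ), ‖φ‖ ≤ 1 → ∑ j ∈ s, |φ (x j)| ^ p ≤ W := by
  have hp0 : 0 < p := by linarith
  have : Fact (1 ≤ ENNReal.ofReal p) := ⟨by simpa using ENNReal.ofReal_le_ofReal hp⟩
  have hpr : (ENNReal.ofReal p).toReal = p := ENNReal.toReal_ofReal hp0.le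
  let T : Finset ℕ → (E →L[ℝ] ℝ) →L[ℝ] lp (fun _ : ℕ => ℝ) (ENNReal.ofReal p) := fun s =>
    ∑ j ∈ s, (lp.singleContinuousLinearMap ℝ (fun _ : ℕ => ℝ) (ENNReal.ofReal p) j).comp
      (ContinuousLinearMap.apply ℝ ℝ (x j))
  have hT : ∀ s φ, ‖T s φ‖ ^ p = ∑ j ∈ s, |φ (x j)| ^ p := by
    intro s φ
    have h := lp.norm_sum_single (E := fun _ : ℕ => ℝ) (p := ENNReal.ofReal p)
      (by rwa [hpr]) (fun j => φ (x j)) s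
    rw [hpr] at h
    simpa [T] using h
  obtain ⟨K, hK⟩ := banach_steinhaus (g := T) (fun φ => by
    refine ⟨(∑' j, |φ (x j)| ^ p) ^ (1 / p), fun s => ?_⟩
    rw [one_div, Real.le_rpow_inv_iff_of_pos (norm_nonneg _)
      (tsum_nonneg fun j => by positivity) hp0, hT]
    exact (hx φ).sum_le_tsum s fun j _ => by positivity)
  refine ⟨max K 0 ^ p + 1, by positivity, fun s φ hφ => ?_⟩
  rw [← hT]
  have h1 : ‖T s φ‖ ≤ max K 0 := by
    refine ((T s).le_opNorm_of_le hφ).trans ?_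
    simpa using Or.inl (hK s)
  have := Real.rpow_le_rpow (norm_nonneg _) h1 hp0.le
  linarith

/-- An absolutely `(p,p)`-summing operator satisfies a uniform inequality on finite families. -/
theorem AbsolutelySumming.exists_bound_s18 {p : ℝ} (hp : 1 ≤ p) {u : E →L[ℝ] F}
    (hu : AbsolutelySumming p p u) :
    ∃ K > 0, ∀ (s : Finset ℕ) (x : ℕ → E) (W : ℝ), 0 < W →
      (∀ φ : E →L[ℝ] ℝ, ‖φ‖ ≤ 1 → ∑ j ∈ s, |φ (x j)| ^ p ≤ W) →
      ∑ j ∈ s, ‖u (x j)‖ ^ p ≤ K * W := by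
  have hp0 : 0 < p := by linarith
  suffices H : ∃ K > 0, ∀ (s : Finset ℕ) (x : ℕ → E),
      (∀ φ : E →L[ℝ] ℝ, ‖φ‖ ≤ 1 → ∑ j ∈ s, |φ (x j)| ^ p ≤ 1) →
      ∑ j ∈ s, ‖u (x j)‖ ^ p ≤ K by
    obtain ⟨K, hK0, hK⟩ := H
    refine ⟨K, hK0, fun s x W hW hx => ?_⟩
    have hc : 0 < W ^ (-(1 / p)) := Real.rpow_pos_of_pos hW _
    have hcp : (W ^ (-(1 / p))) ^ p = W⁻¹ := by
      rw [← Real.rpow_mul hW.le, ← Real.rpow_neg_one]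
      congr 1; field_simp
    have h := hK s (fun j => W ^ (-(1 / p)) • x j) (fun φ hφ => by
      simp only [map_smul, smul_eq_mul, abs_mul, abs_of_pos hc]
      simp_rw [Real.mul_rpow hc.le (abs_nonneg _), hcp, ← Finset.mul_sum]
      rw [inv_mul_le_iff₀ hW]; simpa using hx φ hφ)
    simp only [map_smul, norm_smul, Real.norm_eq_abs, abs_of_pos hc] at h
    simp_rw [Real.mul_rpow hc.le (norm_nonneg _), hcp, ← Finset.mul_sum] at h
    rw [inv_mul_le_iff₀ hW] at h
    linarith
  by_contra! H
  choose s x hx hK using fun k : ℕ => H (2 ^ k) (by positivity)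
  let c : ℕ → ℝ := fun k => ((1 / 2 : ℝ) ^ k) ^ (1 / p)
  have hc : ∀ k, 0 ≤ c k := fun k => by positivity
  have hcp : ∀ k, c k ^ p = (1 / 2) ^ k := fun k => by
    simp only [c]
    rw [← Real.rpow_mul (by positivity), one_div_mul_cancel hp0.ne', Real.rpow_one]
  let y : ℕ × ℕ → E := fun a => if a.2 ∈ s a.1 then c a.1 • x a.1 a.2 else 0
  have hsum : ∀ N : Seminorm ℝ E, ∀ k,
      HasSum (fun j => N (y (k, j)) ^ p) ((1 / 2) ^ k * ∑ j ∈ s k, N (x k j) ^ p) := by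
    intro N k
    rw [Finset.mul_sum]
    have h : HasSum (fun j => N (y (k, j)) ^ p) (∑ j ∈ s k, N (y (k, j)) ^ p) :=
      hasSum_sum_of_ne_finset_zero fun j hj => by simp [y, hj, hp0.ne']
    convert h using 1
    refine Finset.sum_congr rfl fun j hj => ?_
    simp only [y, hj, if_true, map_smul_eq_mul, Real.norm_eq_abs, abs_of_nonneg (hc k)]
    rw [Real.mul_rpow (hc k) (apply_nonneg _ _), hcp]
  have hsumφ : ∀ (φ : E →L[ℝ] ℝ) (k : ℕ), HasSum (fun j => |φ (y (k, j))| ^ p)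
      ((1 / 2) ^ k * ∑ j ∈ s k, |φ (x k j)| ^ p) := fun φ =>
    hsum ((normSeminorm ℝ ℝ).comp φ.toLinearMap)
  have hsumu : ∀ k, HasSum (fun j => ‖u (y (k, j))‖ ^ p)
      ((1 / 2) ^ k * ∑ j ∈ s k, ‖u (x k j)‖ ^ p) :=
    hsum ((normSeminorm ℝ F).comp u.toLinearMap)
  have hz : WeaklySummable p (y ∘ Nat.pairEquiv.symm) := by
    intro φ
    refine (Nat.pairEquiv.symm.summable_iff (f := fun a => |φ (y a)| ^ p)).2 ?_
    refine (summable_prod_of_nonneg fun a => by positivity).2 ⟨fun k => ?_, ?_⟩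
    · exact (hsumφ φ k).summable
    · have : ∀ k, ∑' j, |φ (y (k, j))| ^ p ≤ (1 / 2) ^ k * (‖φ‖ + 1) ^ p := by
        intro k
        rw [(hsumφ φ k).tsum_eq]
        refine mul_le_mul_of_nonneg_left ?_ (by positivity)
        have hφ : 0 < ‖φ‖ + 1 := by positivity
        have h := hx k ((‖φ‖ + 1)⁻¹ • φ) (by
          rw [norm_smul, norm_inv, Real.norm_of_nonneg hφ.le, inv_mul_le_iff₀ hφ]; linarith)
        simp only [smul_apply, smul_eq_mul, abs_mul, abs_of_pos (inv_pos.2 hφ)]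
          at h
        simp_rw [Real.mul_rpow (inv_pos.2 hφ).le (abs_nonneg _), ← Finset.mul_sum,
          Real.inv_rpow hφ.le] at h
        rw [inv_mul_le_iff₀ (by positivity)] at h
        simpa using h
      exact Summable.of_nonneg_of_le (fun k => tsum_nonneg fun j => by positivity) this
        (summable_geometric_two.mul_right _)
  have hzu := hu _ hz
  have hzu' : Summable fun a : ℕ × ℕ => ‖u (y a)‖ ^ p :=
    (Nat.pairEquiv.symm.summable_iff (f := fun a => ‖u (y a)‖ ^ p)).1 hzu
  have h2 := ((summable_prod_of_nonneg fun a => by positivity).1 hzu').2.tendsto_atTop_zero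
  obtain ⟨k, hk⟩ := (h2.eventually (gt_mem_nhds one_pos)).exists
  rw [(hsumu k).tsum_eq] at hk
  have := mul_lt_mul_of_pos_left (hK k) (by positivity : (0 : ℝ) < (1 / 2) ^ k)
  rw [← mul_pow] at this
  norm_num at this hk
  linarith

theorem le_rpow_of_le_mul_rpow {r s : ℝ} (h : r.HolderConjugate s) {A T : ℝ}
    (hA : 0 ≤ A) (hT : 0 ≤ T) (hle : T ≤ A * T ^ (1 / s)) : T ≤ A ^ r := by
  rcases hT.eq_or_lt with rfl | hT
  · positivity
  have hs : 0 < T ^ (1 / s) := by positivity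
  have h1 : T ^ (1 / r) ≤ A := by
    refine le_of_mul_le_mul_right ?_ hs
    rw [← Real.rpow_add hT, one_div, one_div, h.inv_add_inv_eq_one, Real.rpow_one]
    simpa using hle
  calc T = (T ^ (1 / r)) ^ r := by
        rw [← Real.rpow_mul hT.le, one_div_mul_cancel h.ne_zero, Real.rpow_one]
    _ ≤ A ^ r := Real.rpow_le_rpow (by positivity) h1 h.nonneg

/-- Absolutely summing operators are absolutely `r`-summing. -/
theorem AbsolutelySumming.of_one {r : ℝ} (hr : 1 < r) {u : E →L[ℝ] F}
    (hu : AbsolutelySumming 1 1 u) : AbsolutelySumming r r u := by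
  intro x hx
  obtain ⟨W, hW, hxW⟩ := hx.exists_bound_s18 hr.le
  obtain ⟨K, hK, hKu⟩ := hu.exists_bound_s18 le_rfl
  have hrs : r.HolderConjugate r.conjExponent := .conjExponent hr
  set s := r.conjExponent
  refine summable_of_sum_le (c := (K * W ^ (1 / r)) ^ r) (fun j => by positivity) fun t => ?_
  set S := ∑ j ∈ t, ‖u (x j)‖ ^ r with hS
  rcases (show 0 ≤ S from Finset.sum_nonneg fun j _ => by positivity).eq_or_lt with h0 | h0
  · rw [← h0]; positivity
  refine le_rpow_of_le_mul_rpow hrs (by positivity) h0.le ?_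
  have hpow : ∀ j, (‖u (x j)‖ ^ (r - 1)) ^ s = ‖u (x j)‖ ^ r := fun j => by
    rw [← Real.rpow_mul (norm_nonneg _), hrs.sub_one_mul_conj]
  have h := hKu t (fun j => (‖u (x j)‖ ^ (r - 1)) • x j) (W ^ (1 / r) * S ^ (1 / s))
    (by positivity) (fun φ hφ => by
      have h := Real.inner_le_Lp_mul_Lq_of_nonneg t hrs (f := fun j => |φ (x j)|)
        (g := fun j => ‖u (x j)‖ ^ (r - 1)) (fun _ _ => by positivity) (fun _ _ => by positivity)
      simp_rw [hpow, ← hS] at h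
      calc _ = ∑ j ∈ t, |φ (x j)| * ‖u (x j)‖ ^ (r - 1) := by
            refine Finset.sum_congr rfl fun j _ => ?_
            rw [map_smul, smul_eq_mul, abs_mul, Real.rpow_one,
              abs_of_nonneg (by positivity : 0 ≤ ‖u (x j)‖ ^ (r - 1)), mul_comm]
        _ ≤ _ := h
        _ ≤ _ := by
          gcongr
          exact hxW t φ hφ)
  calc S = ∑ j ∈ t, ‖u (‖u (x j)‖ ^ (r - 1) • x j)‖ ^ (1 : ℝ) := by
        refine Finset.sum_congr rfl fun j _ => ?_
        rw [map_smul, norm_smul, Real.rpow_one, Real.norm_of_nonneg (by positivity)]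
        rcases (norm_nonneg (u (x j))).eq_or_lt with h | h
        · rw [← h]; simp [hrs.ne_zero]
        · rw [← Real.rpow_add_one h.ne']; simp
    _ ≤ _ := h
    _ = _ := by ring

theorem abs_rademacher (k : ℕ) (t : ℝ) : |Rademacher k t| = 1 := by
  simp [Rademacher, abs_zpow]

/-- In a space of cotype `q`, contractions defined on `ℓ_∞^n` are uniformly `(q,1)`-summing. -/
theorem HasCotype.exists_bound_s18 {q : ℝ} (h : HasCotype q E) :
    ∃ C > 0, ∀ (ι : Type) [Fintype ι] (v : (ι → ℝ) →ₗ[ℝ] E),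
      (∀ f, (∀ i, |f i| ≤ 1) → ‖v f‖ ≤ 1) → ∀ (m : ℕ) (f : Fin m → ι → ℝ),
      (∀ i, ∑ j, |f j i| ≤ 1) → (∑ j, ‖v (f j)‖ ^ q) ^ (1 / q) ≤ C := by
  obtain ⟨-, C, hC, H⟩ := h
  refine ⟨C, hC, fun ι _ v hv m f hf => (H m fun j => v (f j)).trans ?_⟩
  have hint : ∫ t in (0:ℝ)..(1:ℝ), ‖∑ k : Fin m, Rademacher k.1 t • v (f k)‖ ^ 2 ≤ 1 := by
    refine (Real.le_norm_self _).trans ((intervalIntegral.norm_integral_le_of_norm_le_const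
      (C := 1) fun t _ => ?_).trans (by simp))
    have h1 : ‖∑ k : Fin m, Rademacher k.1 t • v (f k)‖ ≤ 1 := by
      simp_rw [← map_smul, ← map_sum]
      refine hv _ fun i => ?_
      rw [Finset.sum_apply]
      refine (Finset.abs_sum_le_sum_abs _ _).trans ?_
      simpa [abs_mul, abs_rademacher] using hf i
    rw [Real.norm_of_nonneg (by positivity)]
    exact pow_le_one₀ (norm_nonneg _) h1
  have hnn : 0 ≤ ∫ t in (0:ℝ)..(1:ℝ), ‖∑ k : Fin m, Rademacher k.1 t • v (f k)‖ ^ 2 :=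
    intervalIntegral.integral_nonneg zero_le_one fun _ _ => by positivity
  exact mul_le_of_le_one_right hC.le (Real.rpow_le_one hnn hint (by norm_num))

theorem rpow_sub_rpow_le {q c R : ℝ} (hq : 1 ≤ q) (hc : 0 < c) (hR : 0 ≤ R) :
    c ^ q - R ^ q ≤ q * c ^ (q - 1) * (c - R) := by
  have h := one_add_mul_self_le_rpow_one_add (s := R / c - 1)
    (by linarith [div_nonneg hR hc.le]) hq
  rw [add_sub_cancel, Real.div_rpow hR hc.le, le_div_iff₀ (by positivity)] at h
  have h2 : c ^ q = c ^ (q - 1) * c := by rw [← Real.rpow_add_one hc.ne']; simp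
  have h3 : (1 + q * (R / c - 1)) * c ^ q = c ^ q - q * c ^ (q - 1) * (c - R) := by
    rw [h2]; field_simp; ring
  linarith

/-- A nearly extremal family for the `(q,1)`-summing norm of an operator on `ℓ_∞^n` yields a
weight that nearly dominates the operator. -/
theorem exists_weight_of_nearly_extremal {ι : Type*} [Fintype ι] {q c ε : ℝ} (hq : 1 < q)
    (hcpos : 0 < c) (v : (ι → ℝ) →ₗ[ℝ] E)
    (hle : ∀ (m : ℕ) (f : Fin m → ι → ℝ), (∀ i, ∑ j, |f j i| ≤ 1) →
      ∑ j, ‖v (f j)‖ ^ q ≤ c ^ q)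
    {m : ℕ} (f : Fin m → ι → ℝ) (hf : ∀ i, ∑ j, |f j i| ≤ 1) (hεc : ε < c)
    (hcf : c - ε < (∑ j, ‖v (f j)‖ ^ q) ^ (1 / q)) :
    ∃ l : ι → ℝ, ∑ i, l i ≤ c ∧ ∀ g : ι → ℝ, (∀ i, |g i| ≤ 1) →
      ‖v g‖ ^ q ≤ q * c ^ (q - 1) * (ε + ∑ i, l i * |g i|) := by
  classical
  have hq0 : 0 < q := by linarith
  set Q := ∑ j, ‖v (f j)‖ ^ q with hQ
  set N := Q ^ (1 / q) with hN
  have hQ0 : 0 ≤ Q := Finset.sum_nonneg fun _ _ => by positivity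
  have hNc : N ≤ c := by
    rw [hN, one_div, Real.rpow_inv_le_iff_of_pos hQ0 hcpos.le hq0]
    exact hle m f hf
  have hN0 : 0 < N := by linarith
  have hNQ : N ^ q = Q := by
    rw [hN, ← Real.rpow_mul hQ0, one_div_mul_cancel hq0.ne', Real.rpow_one]
  choose φ hφ1 hφ using fun j => exists_dual_vector'' ℝ (v (f j))
  have hqs : q.HolderConjugate q.conjExponent := .conjExponent hq
  set s := q.conjExponent
  let L : (ι → ℝ) → ℝ := fun g => (∑ j, ‖v (f j)‖ ^ (q - 1) * φ j (v (f j * g))) / N ^ (q - 1)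
  have hNq : N ^ q = N * N ^ (q - 1) := by
    rw [mul_comm, ← Real.rpow_add_one hN0.ne']; simp
  have hpow1 : ∀ j, ‖v (f j)‖ ^ (q - 1) * ‖v (f j)‖ = ‖v (f j)‖ ^ q := fun j => by
    rcases (norm_nonneg (v (f j))).eq_or_lt with h | h
    · rw [← h]; simp [hq0.ne']
    · rw [← Real.rpow_add_one h.ne']; simp
  have hL1 : L 1 = N := by
    have : ∑ j, ‖v (f j)‖ ^ (q - 1) * φ j (v (f j * 1)) = N ^ q := by
      rw [hNQ, hQ]
      refine Finset.sum_congr rfl fun j _ => ?_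
      rw [mul_one, hφ, ← hpow1]; rfl
    simp only [L, this, hNq]
    field_simp
  have hLsum : ∀ g, L g = ∑ i, L (Pi.single i 1) * g i := fun g => by
    simp only [L]
    simp_rw [div_mul_eq_mul_div, ← Finset.sum_div, Finset.sum_mul]
    rw [Finset.sum_comm]
    congr 1
    refine Finset.sum_congr rfl fun j _ => ?_
    have : f j * g = ∑ i, g i • (f j * Pi.single i 1) := by
      ext k; simp [Finset.sum_apply, Pi.single_apply, mul_comm]
    rw [this, map_sum, map_sum, Finset.mul_sum]
    refine Finset.sum_congr rfl fun i _ => ?_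
    rw [map_smul, map_smul, smul_eq_mul]; ring
  have hLsub : ∀ g, L (1 - g) = N - L g := fun g => by
    rw [← hL1, hLsum, hLsum 1, hLsum g, ← Finset.sum_sub_distrib]
    exact Finset.sum_congr rfl fun i _ => by simp [mul_sub]
  have hLle : ∀ g, L g ≤ (∑ j, ‖v (f j * g)‖ ^ q) ^ (1 / q) := fun g => by
    rw [div_le_iff₀ (by positivity)]
    have h := Real.inner_le_Lp_mul_Lq_of_nonneg Finset.univ hqs (f := fun j => ‖v (f j * g)‖)
      (g := fun j => ‖v (f j)‖ ^ (q - 1)) (fun _ _ => by positivity) (fun _ _ => by positivity)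
    have hpow : ∀ j, (‖v (f j)‖ ^ (q - 1)) ^ s = ‖v (f j)‖ ^ q := fun j => by
      rw [← Real.rpow_mul (norm_nonneg _), hqs.sub_one_mul_conj]
    have hNs : Q ^ (1 / s) = N ^ (q - 1) := by
      rw [hN, ← Real.rpow_mul hQ0, one_div s, ← hqs.one_sub_inv]
      congr 1; field_simp
    simp_rw [hpow, ← hQ, hNs] at h
    refine le_trans (Finset.sum_le_sum fun j _ => ?_) h
    rw [mul_comm]
    gcongr
    refine (le_abs_self _).trans (((φ j).le_of_opNorm_le (hφ1 j) _).trans_eq (one_mul _))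
  refine ⟨fun i => L (Pi.single i 1), ?_, fun g hg => ?_⟩
  · simpa [← hL1, hLsum 1] using hNc
  · rw [← hLsum fun i => |g i|]
    set a : ι → ℝ := fun i => |g i| with ha
    set R := (∑ j, ‖v (f j * (1 - a))‖ ^ q) ^ (1 / q) with hR
    have hR0 : 0 ≤ R := by positivity
    have hRq : R ^ q = ∑ j, ‖v (f j * (1 - a))‖ ^ q := by
      rw [hR, ← Real.rpow_mul (by positivity), one_div_mul_cancel hq0.ne', Real.rpow_one]
    have h1 := hle (m + 1) (Fin.cons g fun j => f j * (1 - a)) (fun i => by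
      rw [Fin.sum_univ_succ]
      have h1a : 0 ≤ 1 - |g i| := by linarith [hg i]
      simp only [Fin.cons_zero, Fin.cons_succ, Pi.mul_apply, Pi.sub_apply, Pi.one_apply, ha,
        abs_mul, abs_of_nonneg h1a, ← Finset.sum_mul]
      nlinarith [hf i])
    rw [Fin.sum_univ_succ] at h1
    simp only [Fin.cons_zero, Fin.cons_succ, ← hRq] at h1
    have h2 := rpow_sub_rpow_le hq.le hcpos hR0
    have h3 := hLle (1 - a)
    rw [hLsub, ← hR] at h3
    have h4 : c - R ≤ ε + L a := by linarith
    have h5 := mul_le_mul_of_nonneg_left h4 (by positivity : 0 ≤ q * c ^ (q - 1))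
    linarith

/-- The factorization of `(q,1)`-summing operators on `ℓ_∞^n` through a weighted measure (Pisier). -/
theorem exists_weight {ι : Type*} [Fintype ι] {q C : ℝ} (hq : 1 < q) (v : (ι → ℝ) →ₗ[ℝ] E)
    (hC : ∀ (m : ℕ) (f : Fin m → ι → ℝ), (∀ i, ∑ j, |f j i| ≤ 1) →
      (∑ j, ‖v (f j)‖ ^ q) ^ (1 / q) ≤ C) :
    ∃ μ : ι → ℝ, (∀ i, 0 < μ i) ∧ ∑ i, μ i ≤ 1 ∧
      ∀ f : ι → ℝ, (∀ i, |f i| ≤ 1) → (∃ i, |f i| = 1) →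
        ‖v f‖ ^ q ≤ 2 * q * C ^ q * ∑ i, μ i * |f i| := by
  classical
  have hq0 : 0 < q := by linarith
  let S : Set ℝ := {y | ∃ (m : ℕ) (f : Fin m → ι → ℝ), (∀ i, ∑ j, |f j i| ≤ 1) ∧
    y = (∑ j, ‖v (f j)‖ ^ q) ^ (1 / q)}
  have hS0 : (0 : ℝ) ∈ S := ⟨0, fun _ => 0, by simp, by simp [hq0.ne']⟩
  have hSb : BddAbove S := ⟨C, by rintro y ⟨m, f, hf, rfl⟩; exact hC m f hf⟩
  set c := sSup S with hc
  have hcC : c ≤ C := csSup_le ⟨0, hS0⟩ (by rintro y ⟨m, f, hf, rfl⟩; exact hC m f hf)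
  have hc0 : 0 ≤ c := le_csSup hSb hS0
  have hle : ∀ (m : ℕ) (f : Fin m → ι → ℝ), (∀ i, ∑ j, |f j i| ≤ 1) →
      ∑ j, ‖v (f j)‖ ^ q ≤ c ^ q := fun m f hf => by
    have h := le_csSup hSb (⟨m, f, hf, rfl⟩ : _ ∈ S)
    rwa [one_div, Real.rpow_inv_le_iff_of_pos (by positivity) hc0 hq0] at h
  have hn : (0 : ℝ) ≤ Fintype.card ι := by positivity
  rcases hc0.eq_or_lt with h0 | hcpos
  · refine ⟨fun _ => 1 / (Fintype.card ι + 1), fun _ => by positivity, ?_, fun f hf _ => ?_⟩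
    · simp only [Finset.sum_const, Finset.card_univ, nsmul_eq_mul]
      rw [mul_one_div, div_le_one (by positivity)]; linarith
    · have h := hle 1 (fun _ => f) (by simpa using hf)
      rw [← h0, Real.zero_rpow hq0.ne'] at h
      have hC0 : 0 ≤ C := hc0.trans hcC
      refine le_trans (by simpa using h) ?_
      positivity
  set ε := c / (2 * Fintype.card ι + 2) with hε
  have hε0 : 0 < ε := by positivity
  have hεn : 2 * Fintype.card ι * ε + 2 * ε = c := by rw [hε]; field_simp
  have hεc : ε < c := by nlinarith [mul_nonneg hn hε0.le]
  obtain ⟨_, ⟨m, f, hf, rfl⟩, hcf⟩ := exists_lt_of_lt_csSup ⟨0, hS0⟩ (sub_lt_self c hε0)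
  obtain ⟨l, hl, key⟩ := exists_weight_of_nearly_extremal hq hcpos v hle f hf hεc hcf
  have hLi : ∀ i, 0 ≤ ε + l i := fun i => by
    have h := key (Pi.single i 1) (fun k => by by_cases h : k = i <;> simp [h])
    have habs : ∑ k, l k * |(Pi.single i (1 : ℝ) : ι → ℝ) k| = l i := by
      rw [Finset.sum_eq_single i (fun k _ hk => by simp [hk]) (by simp)]; simp
    rw [habs] at h
    exact nonneg_of_mul_nonneg_right ((by positivity : (0:ℝ) ≤ _).trans h) (by positivity)
  refine ⟨fun i => (l i + 2 * ε) / (2 * c), fun i => ?_, ?_, fun g hg hg1 => ?_⟩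
  · have := hLi i
    exact div_pos (by linarith) (by positivity)
  · rw [← Finset.sum_div, div_le_one (by positivity), Finset.sum_add_distrib]
    simp only [Finset.sum_const, Finset.card_univ, nsmul_eq_mul]
    nlinarith
  · obtain ⟨i₀, hi₀⟩ := hg1
    have h1 : ε + ∑ i, l i * |g i| ≤ ∑ i, (l i + 2 * ε) * |g i| := by
      simp_rw [add_mul, Finset.sum_add_distrib, ← Finset.mul_sum]
      have : 1 ≤ ∑ i, |g i| := by
        rw [← hi₀]
        exact Finset.single_le_sum (f := fun i => |g i|) (fun _ _ => abs_nonneg _)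
          (Finset.mem_univ i₀)
      nlinarith
    have h2 := mul_le_mul_of_nonneg_left h1 (by positivity : 0 ≤ q * c ^ (q - 1))
    have hnn : 0 ≤ ∑ i, (l i + 2 * ε) / (2 * c) * |g i| :=
      Finset.sum_nonneg fun i _ => mul_nonneg
        (div_nonneg (by linarith [hLi i]) (by positivity)) (abs_nonneg _)
    have h3 : q * c ^ (q - 1) * ∑ i, (l i + 2 * ε) * |g i| =
        2 * q * c ^ q * ∑ i, (l i + 2 * ε) / (2 * c) * |g i| := by
      simp_rw [div_mul_eq_mul_div, ← Finset.sum_div]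
      have : c ^ q = c ^ (q - 1) * c := by rw [← Real.rpow_add_one hcpos.ne']; simp
      rw [this]; field_simp
    calc ‖v g‖ ^ q ≤ _ := key g hg
      _ ≤ _ := h2
      _ = _ := h3
      _ ≤ _ := by gcongr

theorem norm_layer_le {ι : Type*} [Fintype ι] {q s B X : ℝ} (hq : 1 < q) (hqs : q < s)
    (hB : 0 ≤ B) (hX : 0 < X) (v : (ι → ℝ) →ₗ[ℝ] E) {μ : ι → ℝ} (hμ : ∀ i, 0 < μ i)
    (H : ∀ f : ι → ℝ, (∀ i, |f i| ≤ 1) → (∃ i, |f i| = 1) →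
      ‖v f‖ ^ q ≤ B * ∑ i, μ i * |f i|)
    (f : ι → ℝ) (hf : ∀ i, f i ≠ 0 → X < |f i|) (hf2 : ∀ i, |f i| ≤ 2 * X)
    (hs : ∑ i, μ i * |f i| ^ s ≤ 1) :
    ‖v f‖ ≤ (B * 2 ^ (q - 1)) ^ (1 / q) * (X ^ (-((s - q) / q))) := by
  have hq0 : 0 < q := by linarith
  by_cases hf0 : f = 0
  · rw [hf0, map_zero, norm_zero]; positivity
  obtain ⟨i₁, hi₁⟩ := Function.ne_iff.1 hf0
  have : Nonempty ι := ⟨i₁⟩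
  obtain ⟨i₀, hi₀⟩ := Finite.exists_max fun i => |f i|
  set t := |f i₀| with ht
  have ht0 : 0 < t := (abs_pos.2 hi₁).trans_le (hi₀ i₁)
  have h1 := H (t⁻¹ • f) (fun i => by
      simpa [abs_mul, ← ht, abs_of_pos ht0, inv_mul_le_iff₀ ht0] using hi₀ i)
    ⟨i₀, by simp [abs_mul, ← ht, abs_of_pos ht0, ht0.ne']⟩
  have h2 : ‖v f‖ ^ q = t ^ q * ‖v (t⁻¹ • f)‖ ^ q := by
    rw [map_smul, norm_smul, norm_inv, Real.norm_of_nonneg ht0.le,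
      Real.mul_rpow (by positivity) (norm_nonneg _), Real.inv_rpow ht0.le]
    field_simp
  have h3 : ∑ i, μ i * |(t⁻¹ • f) i| = t⁻¹ * ∑ i, μ i * |f i| := by
    rw [Finset.mul_sum]
    refine Finset.sum_congr rfl fun i _ => ?_
    rw [Pi.smul_apply, smul_eq_mul, abs_mul, abs_of_pos (inv_pos.2 ht0)]; ring
  have h4 : X ^ (s - 1) * ∑ i, μ i * |f i| ≤ 1 := by
    refine le_trans ?_ hs
    rw [Finset.mul_sum]
    refine Finset.sum_le_sum fun i _ => ?_
    by_cases hi : f i = 0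
    · simp [hi, (by linarith : s ≠ 0)]
    · have h5 : |f i| ^ s = |f i| ^ (s - 1) * |f i| := by
        rw [← Real.rpow_add_one (abs_pos.2 hi).ne']; simp
      have h6 : X ^ (s - 1) ≤ |f i| ^ (s - 1) :=
        Real.rpow_le_rpow hX.le (hf i hi).le (by linarith)
      rw [h5]
      have := mul_le_mul_of_nonneg_right h6 (mul_nonneg (hμ i).le (abs_nonneg (f i)))
      linarith
  have h4' : ∑ i, μ i * |f i| ≤ X ^ (-(s - 1)) := by
    rwa [Real.rpow_neg hX.le, ← mul_one (_⁻¹), le_inv_mul_iff₀ (by positivity)]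
  have htq : t ^ q = t ^ (q - 1) * t := by rw [← Real.rpow_add_one ht0.ne']; simp
  have hXX : X ^ (q - 1) * X ^ (-(s - 1)) = (X ^ (-((s - q) / q))) ^ q := by
    rw [← Real.rpow_add hX, ← Real.rpow_mul hX.le]
    congr 1; field_simp; ring
  have hbound : ‖v f‖ ^ q ≤ ((B * 2 ^ (q - 1)) ^ (1 / q) * (X ^ (-((s - q) / q)))) ^ q := by
    rw [h2, Real.mul_rpow (by positivity) (by positivity), ← hXX, ← Real.rpow_mul (by positivity),
      one_div_mul_cancel hq0.ne', Real.rpow_one]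
    calc t ^ q * ‖v (t⁻¹ • f)‖ ^ q ≤ t ^ q * (B * (t⁻¹ * ∑ i, μ i * |f i|)) := by
          rw [← h3]; gcongr
      _ = B * t ^ (q - 1) * ∑ i, μ i * |f i| := by rw [htq]; field_simp
      _ ≤ B * (2 * X) ^ (q - 1) * X ^ (-(s - 1)) := by
          have : t ^ (q - 1) ≤ (2 * X) ^ (q - 1) :=
            Real.rpow_le_rpow ht0.le (hf2 i₀) (by linarith)
          have : 0 ≤ ∑ i, μ i * |f i| :=
            Finset.sum_nonneg fun i _ => mul_nonneg (hμ i).le (abs_nonneg _)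
          gcongr
      _ = _ := by rw [Real.mul_rpow two_pos.le hX.le]; ring
  exact (Real.rpow_le_rpow_iff (norm_nonneg _) (by positivity) hq0).1 hbound

theorem norm_le_of_weight {ι : Type*} [Fintype ι] {q s B : ℝ} (hq : 1 < q) (hqs : q < s)
    (hB : 0 ≤ B) (v : (ι → ℝ) →ₗ[ℝ] E) (hv : ∀ f, (∀ i, |f i| ≤ 1) → ‖v f‖ ≤ 1)
    {μ : ι → ℝ} (hμ : ∀ i, 0 < μ i)
    (H : ∀ f : ι → ℝ, (∀ i, |f i| ≤ 1) → (∃ i, |f i| = 1) →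
      ‖v f‖ ^ q ≤ B * ∑ i, μ i * |f i|)
    (a : ι → ℝ) (ha : ∑ i, μ i * |a i| ^ s ≤ 1) :
    ‖v a‖ ≤ 1 + (B * 2 ^ (q - 1)) ^ (1 / q) * (1 - 2 ^ (-((s - q) / q)))⁻¹ := by
  have hs0 : 0 < s := by linarith
  set ρ : ℝ := 2 ^ (-((s - q) / q)) with hρ
  set A : ℝ := (B * 2 ^ (q - 1)) ^ (1 / q) with hA
  have hA0 : 0 ≤ A := by positivity
  have hρ0 : 0 ≤ ρ := by positivity
  have hρ1 : ρ < 1 := Real.rpow_lt_one_of_one_lt_of_neg one_lt_two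
    (neg_neg_of_pos (div_pos (by linarith) (by linarith)))
  have main : ∀ n : ℕ, ‖v fun i => if |a i| ≤ 2 ^ n then a i else 0‖ ≤
      1 + A * ∑ k ∈ Finset.range n, ρ ^ k := by
    intro n
    induction n with
    | zero =>
      simp only [pow_zero, Finset.range_zero, Finset.sum_empty, mul_zero, add_zero]
      refine hv _ fun i => ?_
      split_ifs with h
      · exact h
      · simp
    | succ n ih =>
      have hsplit : (fun i => if |a i| ≤ 2 ^ (n + 1) then a i else 0) =
          (fun i => if |a i| ≤ 2 ^ n then a i else 0) +
          fun i => if (2 : ℝ) ^ n < |a i| ∧ |a i| ≤ 2 * 2 ^ n then a i else 0 := by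
        ext i
        have h2 : (2 : ℝ) ^ n ≤ 2 * 2 ^ n := by linarith [pow_pos (two_pos (α := ℝ)) n]
        simp only [Pi.add_apply, pow_succ']
        by_cases h : |a i| ≤ 2 ^ n
        · simp [h, h.trans h2, not_lt.2 h]
        · simp [h, not_le.1 h]
      rw [hsplit, map_add, Finset.sum_range_succ, mul_add, ← add_assoc]
      refine (norm_add_le _ _).trans (add_le_add ih ?_)
      have h := norm_layer_le hq hqs hB (X := 2 ^ n) (by positivity) v hμ H
        (fun i => if (2 : ℝ) ^ n < |a i| ∧ |a i| ≤ 2 * 2 ^ n then a i else 0)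
        (fun i hi => by
          split_ifs at hi ⊢ with h
          · exact h.1
          · exact absurd rfl hi)
        (fun i => by
          split_ifs with h
          · exact h.2
          · simp)
        (le_trans (Finset.sum_le_sum fun i _ => by
          refine mul_le_mul_of_nonneg_left
            (Real.rpow_le_rpow (abs_nonneg _) ?_ hs0.le) (hμ i).le
          split_ifs <;> simp) ha)
      refine h.trans_eq ?_
      rw [hρ, ← Real.rpow_natCast, ← Real.rpow_natCast, ← Real.rpow_mul two_pos.le,
        ← Real.rpow_mul two_pos.le, mul_comm (n : ℝ)]
  obtain ⟨n, hn⟩ : ∃ n : ℕ, ∀ i, |a i| ≤ 2 ^ n := by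
    obtain ⟨n, hn⟩ := pow_unbounded_of_one_lt (∑ i, |a i|) (one_lt_two (α := ℝ))
    exact ⟨n, fun i => (Finset.single_le_sum (f := fun i => |a i|) (fun _ _ => abs_nonneg _)
      (Finset.mem_univ i)).trans hn.le⟩
  have h := main n
  simp only [hn, if_true] at h
  refine h.trans ?_
  gcongr
  rw [← tsum_geometric_of_lt_one hρ0 hρ1]
  exact (summable_geometric_of_lt_one hρ0 hρ1).sum_le_tsum _ fun _ _ => by positivity

/-- In a space of cotype `q`, finite weakly `1`-summable families factor through a weighted `ℓ_s`
space for every `s > q`, with uniform constants. -/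
theorem HasCotype.exists_factorization {q s : ℝ} (hE : HasCotype q E) (hqs : q < s) :
    ∃ M > 0, ∀ (t : Finset ℕ) (x : ℕ → E),
      (∀ φ : E →L[ℝ] ℝ, ‖φ‖ ≤ 1 → ∑ j ∈ t, |φ (x j)| ≤ 1) →
      ∃ μ : ℕ → ℝ, (∀ j, 0 < μ j) ∧ ∑ j ∈ t, μ j ≤ 1 ∧
        ∀ a : ℕ → ℝ, ‖∑ j ∈ t, a j • x j‖ ≤ M * (∑ j ∈ t, μ j * |a j| ^ s) ^ (1 / s) := by
  classical
  obtain ⟨C, hC, hCE⟩ := hE.exists_bound_s18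
  have hq : 1 < q := by linarith [hE.1]
  have hs0 : 0 < s := by linarith
  have hρ1 : (2 : ℝ) ^ (-((s - q) / q)) < 1 := Real.rpow_lt_one_of_one_lt_of_neg one_lt_two
    (neg_neg_of_pos (div_pos (by linarith) (by linarith)))
  set M := 1 + (2 * q * C ^ q * 2 ^ (q - 1)) ^ (1 / q) * (1 - 2 ^ (-((s - q) / q)))⁻¹ with hM
  have hM0 : 0 < M := by
    have := inv_pos.2 (sub_pos.2 hρ1)
    positivity
  refine ⟨M, hM0, fun t x hx => ?_⟩
  let v : (t → ℝ) →ₗ[ℝ] E := Fintype.linearCombination ℝ fun i : t => x i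
  have hva : ∀ f, v f = ∑ i : t, f i • x i := fun f => Fintype.linearCombination_apply ..
  have hv : ∀ f, (∀ i, |f i| ≤ 1) → ‖v f‖ ≤ 1 := fun f hf => by
    obtain ⟨φ, hφ, hφv⟩ := exists_dual_vector'' ℝ (v f)
    have h1 : ‖v f‖ = ∑ i : t, f i * φ (x i) := by
      rw [show ‖v f‖ = φ (v f) from hφv.symm, hva, map_sum]; simp
    rw [h1]
    refine le_trans (Finset.sum_le_sum fun i _ => ?_)
      ((Finset.sum_coe_sort t fun j => |φ (x j)|).trans_le (hx φ hφ))
    refine (le_abs_self _).trans ?_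
    rw [abs_mul]
    exact mul_le_of_le_one_left (abs_nonneg _) (hf i)
  obtain ⟨μ, hμ, hμ1, H⟩ := exists_weight hq v (hCE t v hv)
  refine ⟨fun j => if h : j ∈ t then μ ⟨j, h⟩ else 1, fun j => ?_, ?_, fun a => ?_⟩
  · dsimp only
    split_ifs
    · exact hμ _
    · exact one_pos
  · rw [← Finset.sum_coe_sort]
    simpa using hμ1
  · rw [← Finset.sum_coe_sort t, ← Finset.sum_coe_sort t]
    simp only [Finset.coe_mem, dite_true, Subtype.coe_eta]
    set A := ∑ i : t, μ i * |a i| ^ s with hA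
    have hnn : ∀ i : t, 0 ≤ μ i * |a i| ^ s := fun i => mul_nonneg (hμ i).le (by positivity)
    rw [← hva fun i : t => a i]
    rcases (Finset.sum_nonneg fun i _ => hnn i : 0 ≤ A).eq_or_lt with h0 | h0
    · have hz : (fun i : t => a i) = 0 := by
        ext i
        have := (Finset.sum_eq_zero_iff_of_nonneg fun i _ => hnn i).1 h0.symm i (Finset.mem_univ i)
        have := (mul_eq_zero.1 this).resolve_left (hμ i).ne'
        simpa using (Real.rpow_eq_zero_iff_of_nonneg (abs_nonneg _)).1 this |>.1
      rw [hz, map_zero, norm_zero]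
      positivity
    · have hb : 0 < A ^ (1 / s) := by positivity
      have hbs : (A ^ (1 / s)) ^ s = A := by
        rw [← Real.rpow_mul h0.le, one_div_mul_cancel hs0.ne', Real.rpow_one]
      have h := norm_le_of_weight hq hqs (by positivity) v hv hμ H
        ((A ^ (1 / s))⁻¹ • fun i : t => a i) (by
          simp only [Pi.smul_apply, smul_eq_mul, abs_mul, abs_of_pos (inv_pos.2 hb)]
          have h1 : ∀ i : t, μ i * ((A ^ (1 / s))⁻¹ * |a i|) ^ s = A⁻¹ * (μ i * |a i| ^ s) :=
            fun i => by
              rw [Real.mul_rpow (inv_pos.2 hb).le (abs_nonneg _), Real.inv_rpow hb.le, hbs,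
                mul_left_comm]
          simp_rw [h1, ← Finset.mul_sum, ← hA]
          rw [inv_mul_cancel₀ h0.ne'])
      rw [map_smul, norm_smul, norm_inv, Real.norm_of_nonneg hb.le, inv_mul_le_iff₀ hb] at h
      rw [mul_comm]
      exact h

/-- Duality: if `a ↦ ∑ a j • y j` is bounded by `M` on `ℓ_s`, then `y` is weakly `r`-summable with
constant `M`, where `r` and `s` are conjugate. -/
theorem sum_abs_rpow_le_of_norm_sum_le {r s M : ℝ} (hrs : r.HolderConjugate s) (hM : 0 ≤ M)
    {t : Finset ℕ} {y : ℕ → E}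
    (H : ∀ a : ℕ → ℝ, ‖∑ j ∈ t, a j • y j‖ ≤ M * (∑ j ∈ t, |a j| ^ s) ^ (1 / s))
    (φ : E →L[ℝ] ℝ) (hφ : ‖φ‖ ≤ 1) : ∑ j ∈ t, |φ (y j)| ^ r ≤ M ^ r := by
  refine le_rpow_of_le_mul_rpow hrs hM (Finset.sum_nonneg fun _ _ => by positivity) ?_
  have h := H fun j => SignType.sign (φ (y j)) * |φ (y j)| ^ (r - 1)
  have h1 : ∀ j, |(SignType.sign (φ (y j)) : ℝ) * |φ (y j)| ^ (r - 1)| ^ s = |φ (y j)| ^ r := by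
    intro j
    by_cases h0 : φ (y j) = 0
    · simp [h0, hrs.ne_zero, hrs.symm.ne_zero]
    · have : |(SignType.sign (φ (y j)) : ℝ)| = 1 := by
        rcases lt_or_gt_of_ne h0 with h | h <;> simp [h]
      rw [abs_mul, this, one_mul, abs_of_nonneg (by positivity : 0 ≤ |φ (y j)| ^ (r - 1)),
        ← Real.rpow_mul (abs_nonneg _), hrs.sub_one_mul_conj]
  simp_rw [h1] at h
  refine le_trans ?_ h
  refine le_trans ?_ (((le_abs_self _).trans (φ.le_of_opNorm_le hφ _)).trans_eq (one_mul _))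
  rw [map_sum]
  refine Finset.sum_le_sum fun j _ => ?_
  rw [map_smul, smul_eq_mul, mul_right_comm, sign_mul_self]
  by_cases h0 : φ (y j) = 0
  · simp [h0, hrs.ne_zero]
  · rw [mul_comm, ← Real.rpow_add_one (abs_pos.2 h0).ne']; simp

/-- On a space of cotype `q`, absolutely `r`-summing operators with `1 < r < q*` are
absolutely summing. -/
theorem AbsolutelySumming.one_of_hasCotype {q r s : ℝ} (hE : HasCotype q E)
    (hrs : r.HolderConjugate s) (hqs : q < s) {u : E →L[ℝ] F} (hu : AbsolutelySumming r r u) :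
    AbsolutelySumming 1 1 u := by
  intro x hx
  obtain ⟨W, hW, hxW⟩ := hx.exists_bound_s18 le_rfl
  obtain ⟨K, hK, hKu⟩ := hu.exists_bound_s18 hrs.lt.le
  obtain ⟨M, hM, hME⟩ := hE.exists_factorization hqs
  simp only [Real.rpow_one] at hxW ⊢
  refine summable_of_sum_le (c := W * (K * M ^ r) ^ (1 / r)) (fun j => norm_nonneg _) fun t => ?_
  obtain ⟨μ, hμ, hμ1, H⟩ := hME t (fun j => W⁻¹ • x j) fun φ hφ => by
    simp only [map_smul, smul_eq_mul, abs_mul, abs_of_pos (inv_pos.2 hW), ← Finset.mul_sum]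
    rw [inv_mul_le_iff₀ hW, mul_one]
    exact hxW t φ hφ
  have hμs : ∀ j, 0 < μ j ^ (1 / s) := fun j => Real.rpow_pos_of_pos (hμ j) _
  have hμss : ∀ j, (μ j ^ (1 / s)) ^ s = μ j := fun j => by
    rw [← Real.rpow_mul (hμ j).le, one_div_mul_cancel hrs.symm.ne_zero, Real.rpow_one]
  let y : ℕ → E := fun j => (μ j ^ (1 / s))⁻¹ • W⁻¹ • x j
  have hy : ∀ a : ℕ → ℝ, ‖∑ j ∈ t, a j • y j‖ ≤ M * (∑ j ∈ t, |a j| ^ s) ^ (1 / s) := by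
    intro a
    have h := H fun j => a j * (μ j ^ (1 / s))⁻¹
    have h1 : ∀ j, μ j * |a j * (μ j ^ (1 / s))⁻¹| ^ s = |a j| ^ s := fun j => by
      rw [abs_mul, abs_of_pos (inv_pos.2 (hμs j)), Real.mul_rpow (abs_nonneg _)
        (inv_pos.2 (hμs j)).le, Real.inv_rpow (hμs j).le, hμss, mul_left_comm,
        mul_inv_cancel₀ (hμ j).ne', mul_one]
    simpa only [h1, mul_smul] using h
  have hyu := hKu t y (M ^ r) (by positivity) (sum_abs_rpow_le_of_norm_sum_le hrs hM.le hy)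
  have hxy : ∀ j, ‖u (x j)‖ = W * (‖u (y j)‖ * μ j ^ (1 / s)) := fun j => by
    have := (hμs j).ne'
    simp only [y, map_smul, norm_smul, norm_inv, Real.norm_of_nonneg (hμs j).le,
      Real.norm_of_nonneg hW.le]
    field_simp
  simp_rw [hxy, ← Finset.mul_sum]
  refine mul_le_mul_of_nonneg_left ?_ hW.le
  refine (Real.inner_le_Lp_mul_Lq_of_nonneg t hrs (fun _ _ => norm_nonneg _)
    fun j _ => (hμs j).le).trans ?_
  simp_rw [hμss]
  have h1 : (∑ j ∈ t, μ j) ^ (1 / s) ≤ 1 :=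
    Real.rpow_le_one (Finset.sum_nonneg fun j _ => (hμ j).le) hμ1 (one_div_nonneg.2 hrs.symm.nonneg)
  have h2 : (∑ j ∈ t, ‖u (y j)‖ ^ r) ^ (1 / r) ≤ (K * M ^ r) ^ (1 / r) :=
    Real.rpow_le_rpow (Finset.sum_nonneg fun _ _ => by positivity) hyu
      (one_div_nonneg.2 hrs.nonneg)
  exact (mul_le_of_le_one_right (Real.rpow_nonneg (Finset.sum_nonneg fun _ _ => by positivity) _)
    h1).trans h2

end Helpers

/-- Diestel–Jarchow–Tonge, cotype `q > 2` case: if `E` has cotype `q > 2`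
and `1 < r < q*`, then `Π_r(E;F) = Π₁(E;F)`. -/
theorem stmt18 (E F : Type*) [NormedAddCommGroup E] [NormedSpace ℝ E] [CompleteSpace E]
    [NormedAddCommGroup F] [NormedSpace ℝ F] [CompleteSpace F]
    (q : ℝ) (hq : 2 < q) (hcot : HasCotype q E)
    (r : ℝ) (hr1 : 1 < r) (hr2 : r < q / (q - 1)) (u : E →L[ℝ] F) :
    AbsolutelySumming r r u ↔ AbsolutelySumming 1 1 u := by
  have hrs : r.HolderConjugate r.conjExponent := .conjExponent hr1
  refine ⟨fun h => h.one_of_hasCotype hcot hrs ?_, fun h => h.of_one hr1⟩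
  rw [lt_div_iff₀ (by linarith)] at hr2
  rw [Real.conjExponent, lt_div_iff₀ (by linarith)]
  linarith

end
end
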